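/- For every M ≥ 1 there exist constants c_M and C_M such that the following holds for every prime power q. Let t ≤ M, let W ⊆ (F̄_q)^t be the common zero set of at most M polynomials, each of degree at most M and with all coefficients in F_q, and let D ⊆ (F̄_q)^t likewise be the common zero set of at most M polynomials of degree at most M with coefficients in F_q. Writing W(F_q) = W ∩ F_q^t and D(F_q) = D ∩ F_q^t, one of the following holds: either |W(F_q) \ D(F_q)| ≤ c_M, or |W(F_q) \ D(F_q)| ≥ q·(1 − C_M·q^{−1/2}). -/

import Mathlib

open Polynomial

namespace PlaneCurve

section CoordinateRing
variable {F : Type*} [Field F]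

/-- The `x`-degree of the coefficients of a bivariate polynomial is at most `D`. -/
def XDegLE (f : F[X][X]) (D : ℕ) : Prop := ∀ i, (f.coeff i).natDegree ≤ D

lemma natDegree_det_le {n : ℕ} (M : Matrix (Fin n) (Fin n) F[X]) (e : ℕ)
    (h : ∀ i j, (M i j).natDegree ≤ e) : M.det.natDegree ≤ n * e := by
  rw [Matrix.det_apply]
  refine natDegree_sum_le_of_forall_le _ _ fun σ _ => ?_
  refine (natDegree_smul_le _ _).trans ?_
  refine (natDegree_prod_le _ _).trans ?_
  refine (Finset.sum_le_card_nsmul _ _ e fun i _ => h _ _).trans ?_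
  simp

lemma matrix_mul_natDegree_le {n : ℕ} {M N : Matrix (Fin n) (Fin n) F[X]} {a b : ℕ}
    (hM : ∀ i j, (M i j).natDegree ≤ a) (hN : ∀ i j, (N i j).natDegree ≤ b) (i j) :
    ((M * N) i j).natDegree ≤ a + b := by
  rw [Matrix.mul_apply]
  exact natDegree_sum_le_of_forall_le _ _ fun k _ => natDegree_mul_le_of_le (hM _ _) (hN _ _)

lemma matrix_pow_natDegree_le {n : ℕ} {M : Matrix (Fin n) (Fin n) F[X]} {a : ℕ}
    (hM : ∀ i j, (M i j).natDegree ≤ a) (k : ℕ) (i j) :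
    ((M ^ k) i j).natDegree ≤ k * a := by
  induction k generalizing i j with
  | zero =>
    rw [pow_zero, Matrix.one_apply]; split_ifs <;> simp
  | succ k ih =>
    rw [pow_succ, Nat.succ_mul]
    exact matrix_mul_natDegree_le ih hM i j

variable {f : F[X][X]}

/-- The entries of the multiplication matrix of `w` have degree at most `e`. -/
def MulDegLE (hf : f.Monic) (w : AdjoinRoot f) (e : ℕ) : Prop :=
  ∀ i j, (Algebra.leftMulMatrix (AdjoinRoot.powerBasis' hf).basis w i j).natDegree ≤ e

lemma MulDegLE.mono {hf : f.Monic} {w : AdjoinRoot f} {e e' : ℕ} (h : MulDegLE hf w e)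
    (he : e ≤ e') : MulDegLE hf w e' := fun i j => (h i j).trans he

lemma MulDegLE.mul {hf : f.Monic} {w v : AdjoinRoot f} {a b : ℕ} (hw : MulDegLE hf w a)
    (hv : MulDegLE hf v b) : MulDegLE hf (w * v) (a + b) := by
  intro i j
  rw [map_mul]
  exact matrix_mul_natDegree_le hw hv i j

lemma MulDegLE.pow {hf : f.Monic} {w : AdjoinRoot f} {a : ℕ} (hw : MulDegLE hf w a)
    (k : ℕ) : MulDegLE hf (w ^ k) (k * a) := by
  intro i j
  rw [map_pow]
  exact matrix_pow_natDegree_le hw k i j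

lemma MulDegLE.sum {hf : f.Monic} {ι : Type*} (s : Finset ι) {w : ι → AdjoinRoot f} {e : ℕ}
    (h : ∀ i ∈ s, MulDegLE hf (w i) e) : MulDegLE hf (∑ i ∈ s, w i) e := by
  intro i j
  rw [map_sum, Matrix.sum_apply]
  exact natDegree_sum_le_of_forall_le _ _ fun k hk => h k hk i j

lemma mulDegLE_algebraMap (hf : f.Monic) (p : F[X]) :
    MulDegLE hf (algebraMap F[X] (AdjoinRoot f) p) p.natDegree := by
  intro i j
  rw [AlgHom.commutes, Matrix.algebraMap_matrix_apply]
  split_ifs <;> simp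

lemma MulDegLE.smul {hf : f.Monic} {w : AdjoinRoot f} {e : ℕ} (h : MulDegLE hf w e) (c : F) :
    MulDegLE hf (c • w) e := by
  have : c • w = algebraMap F[X] (AdjoinRoot f) (C c) * w := by
    rw [Algebra.smul_def, IsScalarTower.algebraMap_apply F F[X] (AdjoinRoot f)]; rfl
  rw [this]
  have := (mulDegLE_algebraMap hf (C c)).mul h
  simpa using this

lemma mulDegLE_root (hf : f.Monic) {D : ℕ} (hD : XDegLE f D) :
    MulDegLE hf (AdjoinRoot.root f) D := by
  intro i j
  rw [Algebra.leftMulMatrix_eq_repr_mul]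
  have h1 : (AdjoinRoot.powerBasis' hf).basis j = AdjoinRoot.root f ^ (j : ℕ) := by
    rw [PowerBasis.basis_eq_pow]; rfl
  rw [h1, ← pow_succ']
  have h2 : AdjoinRoot.root f ^ ((j : ℕ) + 1) = AdjoinRoot.mk f (X ^ ((j : ℕ) + 1)) := by simp
  refine (congrArg natDegree
    (AdjoinRoot.powerBasisAux'_repr_apply_to_fun hf _ i)).trans_le ?_
  rw [h2, AdjoinRoot.modByMonicHom_mk]
  have hj : (j : ℕ) < f.natDegree := j.2
  rcases Nat.lt_or_ge ((j : ℕ) + 1) f.natDegree with h | h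
  · rw [(modByMonic_eq_self_iff hf).2, coeff_X_pow]
    · split_ifs <;> simp
    · rw [degree_X_pow, degree_eq_natDegree hf.ne_zero]; exact_mod_cast h
  · have h3 : (j : ℕ) + 1 = f.natDegree := by omega
    have h4 : (X ^ ((j : ℕ) + 1) : F[X][X]) %ₘ f = X ^ ((j : ℕ) + 1) - f := by
      refine (div_modByMonic_unique 1 _ hf ⟨by ring, ?_⟩).2
      rw [h3]
      have := degree_sub_lt_left (p := (X ^ f.natDegree : F[X][X])) (q := f)
        (by rw [degree_X_pow, degree_eq_natDegree hf.ne_zero]) (pow_ne_zero _ X_ne_zero)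
        (by rw [hf.leadingCoeff]; exact (monic_X_pow _).leadingCoeff)
      rwa [degree_X_pow, ← degree_eq_natDegree hf.ne_zero] at this
    rw [h4, coeff_sub, coeff_X_pow]
    refine (natDegree_sub_le_of_le (m := D) (n := D) ?_ (hD _)).trans (max_self D).le
    split_ifs <;> simp

lemma natDegree_norm_le (hf : f.Monic) {w : AdjoinRoot f} {e : ℕ} (h : MulDegLE hf w e) :
    (Algebra.norm F[X] w).natDegree ≤ f.natDegree * e := by
  rw [Algebra.norm_eq_matrix_det (AdjoinRoot.powerBasis' hf).basis]
  exact natDegree_det_le (n := f.natDegree) _ e h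

lemma dvd_algebraMap_norm (hf : f.Monic) (w : AdjoinRoot f) :
    w ∣ algebraMap F[X] (AdjoinRoot f) (Algebra.norm F[X] w) := by
  have := hf.free_adjoinRoot
  have := hf.finite_adjoinRoot
  have h := LinearMap.aeval_self_charpoly (Algebra.lmul F[X] (AdjoinRoot f) w)
  rw [aeval_algHom_apply] at h
  have h2 : aeval w (Algebra.lmul F[X] (AdjoinRoot f) w).charpoly = 0 := by
    have := congrArg (fun L => L 1) h
    simpa using this
  rw [Algebra.norm_apply, LinearMap.det_eq_sign_charpoly_coeff, map_mul]
  refine Dvd.dvd.mul_left ?_ _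
  have h3 := X_dvd_sub_C (p := (Algebra.lmul F[X] (AdjoinRoot f) w).charpoly)
  have h4 := map_dvd (aeval w) h3
  rw [map_sub, h2, aeval_X, aeval_C, zero_sub, dvd_neg] at h4
  exact h4

variable (hf : f.Monic) (hirr : Irreducible f)
include hirr

lemma isDomain_adjoinRoot : IsDomain (AdjoinRoot f) :=
  AdjoinRoot.isDomain_of_prime hirr.prime

include hf

lemma norm_ne_zero {w : AdjoinRoot f} (hw : w ≠ 0) : Algebra.norm F[X] w ≠ 0 := by
  have := hf.free_adjoinRoot
  have := hf.finite_adjoinRoot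
  have := isDomain_adjoinRoot hirr
  exact Algebra.norm_ne_zero_iff.2 hw

lemma norm_algebraMap_sub_root (p : F[X]) :
    Algebra.norm F[X] (algebraMap F[X] (AdjoinRoot f) p - AdjoinRoot.root f) = f.eval p := by
  have := hf.free_adjoinRoot
  have := isDomain_adjoinRoot hirr
  have h1 : minpoly F[X] (AdjoinRoot.powerBasis' hf).gen = f := by
    have h_int := (AdjoinRoot.powerBasis' hf).isIntegral_gen
    refine (eq_of_monic_of_dvd_of_natDegree_le (minpoly.monic h_int) hf ?_ ?_).symm
    · refine minpoly.isIntegrallyClosed_dvd h_int ?_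
      simp
    · rw [PowerBasis.natDegree_minpoly]; rfl
  rw [Algebra.norm_eq_matrix_det (AdjoinRoot.powerBasis' hf).basis, map_sub]
  conv_rhs => rw [← h1, ← charpoly_leftMulMatrix, Matrix.eval_charpoly]
  rw [AlgHom.commutes]; rfl

end CoordinateRing
section PowerSeriesPoint
variable {F : Type*} [Field F]

lemma exists_embedding_powerSeries {f : F[X][X]} (hf : f.Monic) (hirr : Irreducible f) {a b : F}
    (h0 : f.evalEval a b = 0) (h1 : (derivative f).evalEval a b ≠ 0) :
    ∃ ι : AdjoinRoot f →ₐ[F] PowerSeries F, Function.Injective ι ∧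
      ∀ p : F[X], ι (algebraMap F[X] (AdjoinRoot f) p) = (p.comp (X + C a) : F[X]) := by
  let j : F[X] →+* PowerSeries F :=
    (coeToPowerSeries.ringHom (R := F)).comp (compRingHom (X + C a))
  have hj : ∀ p : F[X], j p = ((p.comp (X + C a) : F[X]) : PowerSeries F) := fun p => rfl
  have hcomp : (PowerSeries.constantCoeff (R := F)).comp j = evalRingHom a := by
    ext p <;> simp [hj]
  have hev : ∀ g : F[X][X], PowerSeries.constantCoeff (R := F) ((g.map j).eval (PowerSeries.C b))
      = g.evalEval a b := by
    intro g
    rw [eval_map, ← eval₂_evalRingHom, ← hcomp, Polynomial.hom_eval₂,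
      PowerSeries.constantCoeff_C]
  obtain ⟨y, hy, -⟩ := HenselianRing.is_henselian
    (I := Ideal.span {(PowerSeries.X : PowerSeries F)})
    (f.map j) (hf.map j) (PowerSeries.C b)
    (by rw [Ideal.mem_span_singleton, PowerSeries.X_dvd_iff, hev, h0])
    (by
      refine IsUnit.map _ ?_
      rw [derivative_map, PowerSeries.isUnit_iff_constantCoeff, hev]
      exact isUnit_iff_ne_zero.2 h1)
  have hy' : eval₂ j y f = 0 := by rwa [IsRoot, eval_map] at hy
  let ι₀ : AdjoinRoot f →+* PowerSeries F := AdjoinRoot.lift j y hy'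
  have hι : ∀ p : F[X], ι₀ (algebraMap F[X] (AdjoinRoot f) p) = (p.comp (X + C a) : F[X]) := by
    intro p
    rw [AdjoinRoot.algebraMap_eq, AdjoinRoot.lift_of, hj]
  let ι : AdjoinRoot f →ₐ[F] PowerSeries F :=
    { ι₀ with
      commutes' := fun c => by
        have := hι (C c)
        rw [IsScalarTower.algebraMap_apply F F[X] (AdjoinRoot f)]
        simpa using this }
  refine ⟨ι, ?_, hι⟩
  rw [injective_iff_map_eq_zero]
  intro w hw
  by_contra hne
  obtain ⟨v, hv⟩ := dvd_algebraMap_norm hf w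
  have h2 : ι (algebraMap F[X] (AdjoinRoot f) (Algebra.norm F[X] w)) = 0 := by
    rw [hv, map_mul, hw, zero_mul]
  have h3 : ((Algebra.norm F[X] w).comp (X + C a) : F[X]) = 0 := by
    have := (hι _).symm.trans h2
    exact_mod_cast this
  rw [comp_X_add_C_eq_zero_iff] at h3
  exact norm_ne_zero hf hirr hne h3

lemma X_pow_dvd_embedding {f : F[X][X]} (hf : f.Monic) (hirr : Irreducible f) {a : F}
    (ι : AdjoinRoot f →ₐ[F] PowerSeries F)
    (hι : ∀ p : F[X], ι (algebraMap F[X] (AdjoinRoot f) p) = (p.comp (X + C a) : F[X]))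
    {w : AdjoinRoot f} {e q : ℕ} (hw : MulDegLE hf w e) (he : f.natDegree * e < q)
    (hdvd : PowerSeries.X ^ q ∣ ι w) : w = 0 := by
  by_contra hne
  have h1 : PowerSeries.X ^ q ∣ ((Algebra.norm F[X] w).comp (X + C a) : F[X]).toPowerSeries := by
    have := hdvd.trans (map_dvd ι (dvd_algebraMap_norm hf w))
    rwa [hι] at this
  refine norm_ne_zero hf hirr hne ?_
  rw [← comp_X_add_C_eq_zero_iff (t := a)]
  ext i
  rw [coeff_zero]
  rcases lt_or_ge i q with h | h
  · have := PowerSeries.X_pow_dvd_iff.1 h1 i h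
    simpa using this
  · refine coeff_eq_zero_of_natDegree_lt ?_
    rw [natDegree_comp, natDegree_X_add_C, mul_one]
    exact ((natDegree_norm_le hf hw).trans_lt he).trans_le h

variable [Fintype F]

lemma pow_card_eq_truncation (u : PowerSeries F) (n : ℕ) :
    ∃ r : PowerSeries F, u ^ Fintype.card F = PowerSeries.X ^ (Fintype.card F * (n + 1)) * r +
      ∑ j ∈ Finset.range (n + 1), PowerSeries.coeff j u • PowerSeries.X ^ (Fintype.card F * j) := by
  have h1 : ((u.trunc (n + 1) : F[X]) : PowerSeries F) =
      ∑ j ∈ Finset.range (n + 1), PowerSeries.coeff j u • PowerSeries.X ^ j := by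
    ext i
    rw [Polynomial.coeff_coe, PowerSeries.coeff_trunc, map_sum]
    simp [PowerSeries.coeff_X_pow]
  have h2 := congrArg (FiniteField.frobeniusAlgHom F (PowerSeries F))
    (PowerSeries.eq_X_pow_mul_shift_add_trunc (n + 1) u)
  rw [h1, map_add, map_mul, map_sum] at h2
  simp only [map_smul] at h2
  simp only [FiniteField.coe_frobeniusAlgHom, ← pow_mul] at h2
  simp only [mul_comm (Fintype.card F)]
  exact ⟨_, h2⟩

lemma eq_zero_of_sum_mul_pow_card_eq_zero {α κ : Type*} [Fintype α] [Fintype κ]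
    {b : α → PowerSeries F} {e : κ → PowerSeries F} (hb : LinearIndependent F b)
    (he : LinearIndependent F e)
    (hq : ∀ c : α → F, PowerSeries.X ^ Fintype.card F ∣ ∑ i, c i • b i → ∑ i, c i • b i = 0)
    {h : α → κ → F} (hsum : ∑ i, ∑ k, h i k • (b i * e k ^ Fintype.card F) = 0) : h = 0 := by
  set q := Fintype.card F with hqdef
  let w : ℕ → PowerSeries F := fun n => ∑ i, (∑ k, h i k * PowerSeries.coeff n (e k)) • b i
  have hw : ∀ n, w n = 0 := by
    intro n
    induction n using Nat.strong_induction_on with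
    | _ n ih =>
      choose r hr using fun k => pow_card_eq_truncation (e k) n
      have key : (0 : PowerSeries F) = PowerSeries.X ^ (q * (n + 1)) *
          (∑ i, ∑ k, h i k • (b i * r k)) +
          ∑ j ∈ Finset.range (n + 1), PowerSeries.X ^ (q * j) * w j := by
        have hw' : ∀ j, w j = ∑ i, ∑ k, (h i k * PowerSeries.coeff j (e k)) • b i := by
          intro j; simp only [w, Finset.sum_smul]
        simp only [hw']
        rw [← hsum]
        simp only [Finset.mul_sum]
        rw [Finset.sum_comm (s := Finset.range (n + 1)), ← Finset.sum_add_distrib]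
        refine Finset.sum_congr rfl fun i _ => ?_
        rw [Finset.sum_comm (s := Finset.range (n + 1)), ← Finset.sum_add_distrib]
        refine Finset.sum_congr rfl fun k _ => ?_
        rw [hr k, mul_add, smul_add, Finset.mul_sum, Finset.smul_sum]
        congr 1
        · simp only [PowerSeries.smul_eq_C_mul]; ring
        · refine Finset.sum_congr rfl fun j _ => ?_
          simp only [PowerSeries.smul_eq_C_mul, map_mul]; ring
      have hz : ∑ j ∈ Finset.range n, PowerSeries.X ^ (q * j) * w j = 0 :=
        Finset.sum_eq_zero fun j hj => by rw [ih j (Finset.mem_range.1 hj), mul_zero]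
      rw [Finset.sum_range_succ, hz, zero_add] at key
      refine hq _ ?_
      have hX : (PowerSeries.X : PowerSeries F) ^ (q * n) ≠ 0 :=
        pow_ne_zero _ PowerSeries.X_ne_zero
      have h3 : PowerSeries.X ^ (q * n) * (PowerSeries.X ^ q * (∑ i, ∑ k, h i k • (b i * r k)) +
          w n) = PowerSeries.X ^ (q * n) * 0 := by
        rw [mul_zero, key]; ring
      have h4 := mul_left_cancel₀ hX h3
      change _ ∣ w n
      rw [eq_neg_of_add_eq_zero_right h4, dvd_neg]
      exact dvd_mul_right _ _
  have h5 : ∀ n i, ∑ k, h i k * PowerSeries.coeff n (e k) = 0 := fun n i =>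
    Fintype.linearIndependent_iff.1 hb _ (hw n) i
  funext i
  have h6 : ∑ k, h i k • e k = 0 := by
    ext n
    simpa using h5 n i
  funext k
  exact Fintype.linearIndependent_iff.1 he _ h6 k

end PowerSeriesPoint
section AuxiliaryRelation
variable {F B : Type*} [Field F] [CommRing B] [Algebra F B]

/-- The `F`-span of the monomials `X^j T^l y^i Z^k` with `j < n`, `l < m` and `i, k < d`,
enlarged by the ideal generated by `T^m`. -/
def monomialSpan (y X T Z : B) (m d n : ℕ) : Submodule F B :=
  Submodule.span F (Set.range fun p : (Fin n × Fin m) × (Fin d × Fin d) =>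
    X ^ (p.1.1 : ℕ) * T ^ (p.1.2 : ℕ) * (y ^ (p.2.1 : ℕ) * Z ^ (p.2.2 : ℕ))) ⊔
  (Ideal.span {T ^ m}).restrictScalars F

variable {y X T Z : B} {m d n : ℕ}

lemma mem_monomialSpan_of_dvd {z : B} (h : T ^ m ∣ z) :
    z ∈ monomialSpan (F := F) y X T Z m d n :=
  Submodule.mem_sup_right (Ideal.mem_span_singleton.2 h)

lemma monomial_mem_monomialSpan {j l i k : ℕ} (hj : j < n) (hi : i < d) (hk : k < d) :
    X ^ j * T ^ l * (y ^ i * Z ^ k) ∈ monomialSpan (F := F) y X T Z m d n := by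
  rcases Nat.lt_or_ge l m with hl | hl
  · exact Submodule.mem_sup_left (Submodule.subset_span
      ⟨((⟨j, hj⟩, ⟨l, hl⟩), (⟨i, hi⟩, ⟨k, hk⟩)), rfl⟩)
  · exact mem_monomialSpan_of_dvd (((pow_dvd_pow T hl).mul_left _).mul_right _)

lemma mul_mem_monomialSpan {z v : B} {n' : ℕ}
    (h : ∀ j l i k, j < n → i < d → k < d →
      z * (X ^ j * T ^ l * (y ^ i * Z ^ k)) ∈ monomialSpan (F := F) y X T Z m d n')
    (hv : v ∈ monomialSpan (F := F) y X T Z m d n) :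
    z * v ∈ monomialSpan (F := F) y X T Z m d n' := by
  have hle : monomialSpan (F := F) y X T Z m d n ≤
      (monomialSpan (F := F) y X T Z m d n').comap (LinearMap.mulLeft F z) := by
    refine sup_le (Submodule.span_le.2 ?_) ?_
    · rintro _ ⟨p, rfl⟩
      exact h _ _ _ _ p.1.1.2 p.2.1.2 p.2.2.2
    · intro w hw
      exact mem_monomialSpan_of_dvd ((Ideal.mem_span_singleton.1 hw).mul_left z)
  exact hle hv

lemma monomialSpan_mono {n' : ℕ} (h : n ≤ n') :
    monomialSpan (F := F) y X T Z m d n ≤ monomialSpan (F := F) y X T Z m d n' := by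
  intro v hv
  rw [← one_mul v]
  refine mul_mem_monomialSpan (fun j l i k hj hi hk => ?_) hv
  rw [one_mul]
  exact monomial_mem_monomialSpan (hj.trans_le h) hi hk

lemma X_mul_mem_monomialSpan {v : B} (hv : v ∈ monomialSpan (F := F) y X T Z m d n) :
    X * v ∈ monomialSpan (F := F) y X T Z m d (n + 1) := by
  refine mul_mem_monomialSpan (fun j l i k hj hi hk => ?_) hv
  have h : X * (X ^ j * T ^ l * (y ^ i * Z ^ k)) = X ^ (j + 1) * T ^ l * (y ^ i * Z ^ k) := by ring
  rw [h]
  exact monomial_mem_monomialSpan (Nat.succ_lt_succ hj) hi hk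

lemma T_mul_mem_monomialSpan {v : B} (hv : v ∈ monomialSpan (F := F) y X T Z m d n) :
    T * v ∈ monomialSpan (F := F) y X T Z m d n := by
  refine mul_mem_monomialSpan (fun j l i k hj hi hk => ?_) hv
  have h : T * (X ^ j * T ^ l * (y ^ i * Z ^ k)) = X ^ j * T ^ (l + 1) * (y ^ i * Z ^ k) := by ring
  rw [h]
  exact monomial_mem_monomialSpan hj hi hk

lemma add_mul_mem_monomialSpan {v : B} (hv : v ∈ monomialSpan (F := F) y X T Z m d n) :
    (X + T) * v ∈ monomialSpan (F := F) y X T Z m d (n + 1) := by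
  rw [add_mul]
  exact add_mem (X_mul_mem_monomialSpan hv)
    (monomialSpan_mono n.le_succ (T_mul_mem_monomialSpan hv))

lemma pow_mul_mem_monomialSpan {z : B} {e : ℕ}
    (hz : ∀ n v, v ∈ monomialSpan (F := F) y X T Z m d n →
      z * v ∈ monomialSpan (F := F) y X T Z m d (n + e))
    {v : B} (hv : v ∈ monomialSpan (F := F) y X T Z m d n) (i : ℕ) :
    z ^ i * v ∈ monomialSpan (F := F) y X T Z m d (n + i * e) := by
  induction i with
  | zero => simpa using hv
  | succ i ih =>
    rw [pow_succ', mul_assoc, Nat.succ_mul, ← add_assoc]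
    exact hz _ _ ih

lemma aeval_mul_mem_monomialSpan {z : B}
    (hz : ∀ n v, v ∈ monomialSpan (F := F) y X T Z m d n →
      z * v ∈ monomialSpan (F := F) y X T Z m d (n + 1))
    {v : B} (hv : v ∈ monomialSpan (F := F) y X T Z m d n) {p : F[X]} {e : ℕ}
    (hp : p.natDegree ≤ e) :
    aeval z p * v ∈ monomialSpan (F := F) y X T Z m d (n + e) := by
  rw [aeval_eq_sum_range' (Nat.lt_succ_of_le hp), Finset.sum_mul]
  refine sum_mem fun i hi => ?_
  rw [smul_mul_assoc]
  refine Submodule.smul_mem _ _ (monomialSpan_mono ?_ (pow_mul_mem_monomialSpan hz hv i))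
  have := Finset.mem_range.1 hi
  omega

variable {f : F[X][X]} {D : ℕ}

lemma pow_natDegree_eq_neg_sum (hf : f.Monic) {u w : B}
    (h : ∑ i ∈ Finset.range (f.natDegree + 1), aeval u (f.coeff i) * w ^ i = 0) :
    w ^ f.natDegree = ∑ i ∈ Finset.range f.natDegree, - (aeval u (f.coeff i) * w ^ i) := by
  rw [Finset.sum_range_succ, hf.coeff_natDegree, map_one, one_mul] at h
  rw [Finset.sum_neg_distrib]
  exact eq_neg_of_add_eq_zero_right h

lemma y_mul_mem_monomialSpan (hf : f.Monic) (hD : XDegLE f D)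
    (hy : ∑ i ∈ Finset.range (f.natDegree + 1), aeval (X + T) (f.coeff i) * y ^ i = 0)
    {v : B} (hv : v ∈ monomialSpan (F := F) y X T Z m f.natDegree n) :
    y * v ∈ monomialSpan (F := F) y X T Z m f.natDegree (n + D) := by
  refine mul_mem_monomialSpan (fun j l i k hj hi hk => ?_) hv
  have h : y * (X ^ j * T ^ l * (y ^ i * Z ^ k)) = X ^ j * T ^ l * (y ^ (i + 1) * Z ^ k) := by ring
  rw [h]
  rcases Nat.lt_or_ge (i + 1) f.natDegree with h | h
  · exact monomialSpan_mono (Nat.le_add_right _ _) (monomial_mem_monomialSpan hj h hk)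
  · have hi' : i + 1 = f.natDegree := by omega
    rw [hi', pow_natDegree_eq_neg_sum hf hy, Finset.sum_mul, Finset.mul_sum]
    refine sum_mem fun r hr => ?_
    have h2 : X ^ j * T ^ l * (-(aeval (X + T) (f.coeff r) * y ^ r) * Z ^ k) =
      -(aeval (X + T) (f.coeff r) * (X ^ j * T ^ l * (y ^ r * Z ^ k))) := by ring
    rw [h2]
    exact neg_mem (aeval_mul_mem_monomialSpan (fun _ _ => add_mul_mem_monomialSpan)
      (monomial_mem_monomialSpan hj (Finset.mem_range.1 hr) hk) (hD r))

lemma z_mul_mem_monomialSpan (hf : f.Monic) (hD : XDegLE f D)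
    (hZ : ∑ i ∈ Finset.range (f.natDegree + 1), aeval X (f.coeff i) * Z ^ i = 0)
    {v : B} (hv : v ∈ monomialSpan (F := F) y X T Z m f.natDegree n) :
    Z * v ∈ monomialSpan (F := F) y X T Z m f.natDegree (n + D) := by
  refine mul_mem_monomialSpan (fun j l i k hj hi hk => ?_) hv
  have h : Z * (X ^ j * T ^ l * (y ^ i * Z ^ k)) = X ^ j * T ^ l * (y ^ i * Z ^ (k + 1)) := by ring
  rw [h]
  rcases Nat.lt_or_ge (k + 1) f.natDegree with h | h
  · exact monomialSpan_mono (Nat.le_add_right _ _) (monomial_mem_monomialSpan hj hi h)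
  · have hk' : k + 1 = f.natDegree := by omega
    rw [hk', pow_natDegree_eq_neg_sum hf hZ, Finset.mul_sum, Finset.mul_sum]
    refine sum_mem fun r hr => ?_
    have h2 : X ^ j * T ^ l * (y ^ i * -(aeval X (f.coeff r) * Z ^ r)) =
      -(aeval X (f.coeff r) * (X ^ j * T ^ l * (y ^ i * Z ^ r))) := by ring
    rw [h2]
    exact neg_mem (aeval_mul_mem_monomialSpan (fun _ _ => X_mul_mem_monomialSpan)
      (monomial_mem_monomialSpan hj hi (Finset.mem_range.1 hr)) (hD r))

/-- The divided difference `(f(X, y) - f(X, Z)) / (y - Z)`. -/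
noncomputable def dividedDifference (f : F[X][X]) (X y Z : B) : B :=
  ∑ i ∈ Finset.range (f.natDegree + 1), aeval X (f.coeff i) *
    ∑ s ∈ Finset.range i, y ^ s * Z ^ (i - 1 - s)

lemma dividedDifference_mul (f : F[X][X]) (X y Z : B) :
    dividedDifference f X y Z * (y - Z) =
      ∑ i ∈ Finset.range (f.natDegree + 1), aeval X (f.coeff i) * y ^ i -
      ∑ i ∈ Finset.range (f.natDegree + 1), aeval X (f.coeff i) * Z ^ i := by
  rw [dividedDifference, Finset.sum_mul, ← Finset.sum_sub_distrib]
  refine Finset.sum_congr rfl fun i _ => ?_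
  rw [mul_assoc, Commute.geom_sum₂_mul (Commute.all _ _)]
  ring

lemma dvd_dividedDifference_mul
    (hy : ∑ i ∈ Finset.range (f.natDegree + 1), aeval (X + T) (f.coeff i) * y ^ i = 0)
    (hZ : ∑ i ∈ Finset.range (f.natDegree + 1), aeval X (f.coeff i) * Z ^ i = 0) :
    T ∣ dividedDifference f X y Z * (y - Z) := by
  rw [dividedDifference_mul, hZ, ← hy, ← Finset.sum_sub_distrib]
  refine Finset.dvd_sum fun i _ => ?_
  rw [← sub_mul, aeval_def, aeval_def, ← eval_map, ← eval_map]
  refine Dvd.dvd.mul_right ?_ _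
  rw [dvd_sub_comm]
  have h := sub_dvd_eval_sub (X + T) X ((f.coeff i).map (algebraMap F B))
  rwa [add_sub_cancel_left] at h

lemma dividedDifference_mul_mem_monomialSpan (hf : f.Monic) (hD : XDegLE f D)
    (hy : ∑ i ∈ Finset.range (f.natDegree + 1), aeval (X + T) (f.coeff i) * y ^ i = 0)
    (hZ : ∑ i ∈ Finset.range (f.natDegree + 1), aeval X (f.coeff i) * Z ^ i = 0)
    {v : B} (hv : v ∈ monomialSpan (F := F) y X T Z m f.natDegree n) :
    dividedDifference f X y Z * v ∈
      monomialSpan (F := F) y X T Z m f.natDegree (n + f.natDegree * D) := by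
  rw [dividedDifference, Finset.sum_mul]
  refine sum_mem fun i hi => ?_
  rw [mul_assoc, Finset.sum_mul, Finset.mul_sum]
  refine sum_mem fun s hs => ?_
  rw [mul_assoc]
  refine monomialSpan_mono ?_ (aeval_mul_mem_monomialSpan (fun _ _ => X_mul_mem_monomialSpan)
    (pow_mul_mem_monomialSpan (fun _ _ => y_mul_mem_monomialSpan hf hD hy)
    (pow_mul_mem_monomialSpan (fun _ _ => z_mul_mem_monomialSpan hf hD hZ) hv (i - 1 - s)) s)
    (hD i))
  have h1 := Finset.mem_range.1 hi
  have h2 := Finset.mem_range.1 hs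
  have h3 : (i - 1 - s) * D + s * D + D ≤ f.natDegree * D := by
    rw [← add_mul, ← Nat.succ_mul]
    exact Nat.mul_le_mul_right _ (by omega)
  omega

/-- By counting dimensions there is a nontrivial relation modulo `T^m` between the monomials
`x^a y^i X^j Z^k` and the multiples of a power of the divided difference. -/
lemma exists_auxiliary_relation (hf : f.Monic) (hD : XDegLE f D)
    (hy : ∑ i ∈ Finset.range (f.natDegree + 1), aeval (X + T) (f.coeff i) * y ^ i = 0)
    (hZ : ∑ i ∈ Finset.range (f.natDegree + 1), aeval X (f.coeff i) * Z ^ i = 0)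
    (m n A J : ℕ) (hn : n + m * (f.natDegree * D) ≤ A + J)
    (hcard : (A + J) * m * (f.natDegree * f.natDegree) <
      A * f.natDegree * (J * f.natDegree) + m * (n * f.natDegree)) :
    ∃ (h : (Fin A × Fin f.natDegree) × (Fin J × Fin f.natDegree) → F)
      (c : Fin m × (Fin n × Fin f.natDegree) → F), (h ≠ 0 ∨ c ≠ 0) ∧
      T ^ m ∣ (∑ p, h p • ((X + T) ^ (p.1.1 : ℕ) * y ^ (p.1.2 : ℕ) *
          (X ^ (p.2.1 : ℕ) * Z ^ (p.2.2 : ℕ)))) +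
        dividedDifference f X y Z ^ m *
          ∑ p, c p • (T ^ (p.1 : ℕ) * (X ^ (p.2.1 : ℕ) * Z ^ (p.2.2 : ℕ))) := by
  set I : Ideal B := Ideal.span {T ^ m} with hI
  let π : B →ₐ[F] B ⧸ I := Ideal.Quotient.mkₐ F I
  let w : ((Fin A × Fin f.natDegree) × (Fin J × Fin f.natDegree)) ⊕
      (Fin m × (Fin n × Fin f.natDegree)) → B :=
    Sum.elim (fun p => (X + T) ^ (p.1.1 : ℕ) * y ^ (p.1.2 : ℕ) *
          (X ^ (p.2.1 : ℕ) * Z ^ (p.2.2 : ℕ)))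
      (fun p => dividedDifference f X y Z ^ m *
          (T ^ (p.1 : ℕ) * (X ^ (p.2.1 : ℕ) * Z ^ (p.2.2 : ℕ))))
  let gen : (Fin (A + J) × Fin m) × (Fin f.natDegree × Fin f.natDegree) → B := fun p =>
    X ^ (p.1.1 : ℕ) * T ^ (p.1.2 : ℕ) * (y ^ (p.2.1 : ℕ) * Z ^ (p.2.2 : ℕ))
  have hw : ∀ a, w a ∈ monomialSpan (F := F) y X T Z m f.natDegree (A + J) := by
    rintro (p | p)
    · have h : w (Sum.inl p) = (X + T) ^ (p.1.1 : ℕ) *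
          (X ^ (p.2.1 : ℕ) * T ^ 0 * (y ^ (p.1.2 : ℕ) * Z ^ (p.2.2 : ℕ))) := by
        simp only [w, Sum.elim_inl]; ring
      rw [h]
      refine monomialSpan_mono ?_ (pow_mul_mem_monomialSpan (fun _ _ => add_mul_mem_monomialSpan)
        (monomial_mem_monomialSpan p.2.1.2 p.1.2.2 p.2.2.2) p.1.1)
      have := p.1.1.2
      omega
    · have h : w (Sum.inr p) = dividedDifference f X y Z ^ m *
          (X ^ (p.2.1 : ℕ) * T ^ (p.1 : ℕ) * (y ^ 0 * Z ^ (p.2.2 : ℕ))) := by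
        simp only [w, Sum.elim_inr]; ring
      rw [h]
      exact monomialSpan_mono hn (pow_mul_mem_monomialSpan
        (fun _ _ => dividedDifference_mul_mem_monomialSpan hf hD hy hZ)
        (monomial_mem_monomialSpan p.2.1.2 (Nat.zero_lt_of_lt p.2.2.2) p.2.2.2) m)
  have hle : monomialSpan (F := F) y X T Z m f.natDegree (A + J) ≤
      (Submodule.span F (Set.range fun p => π (gen p))).comap π.toLinearMap := by
    refine sup_le (Submodule.span_le.2 ?_) ?_
    · rintro _ ⟨p, rfl⟩
      exact Submodule.subset_span ⟨p, rfl⟩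
    · intro v hv
      have h : π v = 0 := Ideal.Quotient.eq_zero_iff_mem.2 hv
      rw [Submodule.mem_comap, AlgHom.toLinearMap_apply, h]
      exact zero_mem _
  have hnot : ¬ LinearIndependent F fun a => π (w a) := by
    intro hli
    have : Fintype (Set.range fun p => π (gen p)) := Fintype.ofFinite _
    have h1 := linearIndependent_le_span' _ hli (Set.range fun p => π (gen p))
      (by rintro _ ⟨a, rfl⟩; exact hle (hw a))
    have h2 : Fintype.card (Set.range fun p => π (gen p)) ≤ _ := Fintype.card_range_le _
    rw [Cardinal.mk_fintype, Nat.cast_le] at h1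
    have h3 := h1.trans h2
    simp only [Fintype.card_sum, Fintype.card_prod, Fintype.card_fin] at h3
    omega
  obtain ⟨k, hk, a, ha⟩ := Fintype.not_linearIndependent_iff.1 hnot
  refine ⟨fun p => k (Sum.inl p), fun p => k (Sum.inr p), ?_, ?_⟩
  · rcases a with a | a
    · exact Or.inl fun h => ha (congrFun h a)
    · exact Or.inr fun h => ha (congrFun h a)
  · rw [← Ideal.mem_span_singleton, ← Ideal.Quotient.eq_zero_iff_mem]
    change π _ = 0
    rw [← hk, Fintype.sum_sum_type, Finset.mul_sum, map_add, map_sum, map_sum]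
    simp only [w, Sum.elim_inl, Sum.elim_inr, map_smul, mul_smul_comm]

end AuxiliaryRelation
section Diagonal
variable {F : Type*} [Field F] {f : F[X][X]}

lemma sum_coeff_mul_pow_eq {B : Type*} [CommRing B] [Algebra F B] (u v : B) :
    ∑ i ∈ Finset.range (f.natDegree + 1), aeval u (f.coeff i) * v ^ i =
      f.eval₂ (aeval u : F[X] →ₐ[F] B).toRingHom v := by
  rw [eval₂_eq_sum_range]; rfl

lemma aeval_algebraMap_X (p : F[X]) :
    aeval (algebraMap F[X] (AdjoinRoot f) X) p = algebraMap F[X] (AdjoinRoot f) p := by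
  rw [aeval_algebraMap_apply, aeval_X_left_apply]

lemma eval₂_root : f.eval₂ (aeval (algebraMap F[X] (AdjoinRoot f) X) :
    F[X] →ₐ[F] AdjoinRoot f).toRingHom (AdjoinRoot.root f) = 0 := by
  have h : (aeval (algebraMap F[X] (AdjoinRoot f) X) : F[X] →ₐ[F] AdjoinRoot f).toRingHom =
      algebraMap F[X] (AdjoinRoot f) := RingHom.ext aeval_algebraMap_X
  rw [h]
  exact AdjoinRoot.eval₂_root f

lemma linearIndependent_monomials (hf : f.Monic) (n : ℕ) :
    LinearIndependent F fun p : Fin n × Fin f.natDegree =>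
      algebraMap F[X] (AdjoinRoot f) X ^ (p.1 : ℕ) * AdjoinRoot.root f ^ (p.2 : ℕ) := by
  have h1 : LinearIndependent F fun j : Fin n => (X : F[X]) ^ (j : ℕ) := by
    have := (basisMonomials F).linearIndependent.comp (fun j : Fin n => (j : ℕ)) Fin.val_injective
    convert this using 2 with j
    simp [X_pow_eq_monomial]
  have h2 : LinearIndependent F[X] fun k : Fin f.natDegree => AdjoinRoot.root f ^ (k : ℕ) := by
    have := (AdjoinRoot.powerBasis' hf).basis.linearIndependent
    rwa [PowerBasis.coe_basis] at this
  have := linearIndependent_smul h1 h2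
  convert this using 2 with p
  rw [Algebra.smul_def, map_pow]

lemma eq_zero_of_pow_dvd_sum {B O : Type*} [CommRing B] [CommRing O] [IsDomain O] (s : O →+* B)
    (δ : B →+* O) (hδ : ∀ a, δ (s a) = a) {T : B} (hT : ∀ a, T * a = 0 → a = 0) (hδT : δ T = 0)
    {G : B} (hG : δ G ≠ 0) (m : ℕ) (e : Fin m → O)
    (h : T ^ m ∣ G * ∑ l : Fin _, T ^ (l : ℕ) * s (e l)) : e = 0 := by
  induction m with
  | zero => exact Subsingleton.elim _ _
  | succ m ih =>
    have h1 : ∑ l : Fin _, T ^ (l : ℕ) * s (e l) =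
        s (e 0) + T * ∑ l : Fin m, T ^ (l : ℕ) * s (e l.succ) := by
      rw [Fin.sum_univ_succ, Finset.mul_sum]
      simp [pow_succ', mul_assoc]
    rw [h1] at h
    have h0 : e 0 = 0 := by
      have h2 := map_dvd δ ((dvd_pow_self T m.succ_ne_zero).trans h)
      rw [hδT, zero_dvd_iff] at h2
      simpa [hδ, hδT, hG] using h2
    rw [h0, map_zero, zero_add, pow_succ', mul_left_comm] at h
    obtain ⟨k, hk⟩ := h
    have h3 := ih (fun l => e l.succ) ⟨k, by
      rw [← sub_eq_zero]
      refine hT _ ?_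
      rw [mul_sub, hk]; ring⟩
    funext l
    exact Fin.cases h0 (fun l => congrFun h3 l) l

/-- The coordinate ring of the product of the affine curve `f = 0` with itself. -/
abbrev ProductRing (f : F[X][X]) : Type _ :=
  AdjoinRoot (f.map (mapRingHom (algebraMap F (AdjoinRoot f))))

/-- The second coordinate embedding of the coordinate ring. -/
noncomputable def secondFactor (f : F[X][X]) : AdjoinRoot f →ₐ[F] ProductRing f :=
  (IsScalarTower.toAlgHom F (AdjoinRoot f)[X] (ProductRing f)).comp
    (CAlgHom : AdjoinRoot f →ₐ[F] (AdjoinRoot f)[X])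

/-- The first `x`-coordinate. -/
noncomputable def firstX (f : F[X][X]) : ProductRing f :=
  algebraMap (AdjoinRoot f)[X] (ProductRing f) X

lemma aeval_firstX (p : F[X]) : aeval (firstX f) p =
    algebraMap (AdjoinRoot f)[X] (ProductRing f) (p.map (algebraMap F (AdjoinRoot f))) := by
  have : (aeval (firstX f) : F[X] →ₐ[F] ProductRing f) =
      (IsScalarTower.toAlgHom F (AdjoinRoot f)[X] (ProductRing f)).comp
        (mapAlgHom (Algebra.ofId F (AdjoinRoot f))) := by
    ext; simp [firstX]
  exact DFunLike.congr_fun this p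

lemma eval₂_firstX : f.eval₂ (aeval (firstX f) : F[X] →ₐ[F] ProductRing f).toRingHom
    (AdjoinRoot.root _) = 0 := by
  have h : (aeval (firstX f) : F[X] →ₐ[F] ProductRing f).toRingHom =
      (algebraMap (AdjoinRoot f)[X] (ProductRing f)).comp
        (mapRingHom (algebraMap F (AdjoinRoot f))) := RingHom.ext aeval_firstX
  rw [h, ← eval₂_map]
  exact AdjoinRoot.eval₂_root _

lemma exists_productRing_hom {S : Type*} [CommRing S] [Algebra F S] (θ : AdjoinRoot f →ₐ[F] S)
    (u v : S) (huv : f.eval₂ (aeval u : F[X] →ₐ[F] S).toRingHom v = 0) :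
    ∃ Φ : ProductRing f →ₐ[F] S, Φ (firstX f) = u ∧ Φ (AdjoinRoot.root _) = v ∧
      ∀ e, Φ (secondFactor f e) = θ e := by
  have hcomp : (eval₂RingHom θ.toRingHom u).comp (mapRingHom (algebraMap F (AdjoinRoot f))) =
      (aeval u : F[X] →ₐ[F] S).toRingHom := by
    ext <;> simp
  have h0 : (f.map (mapRingHom (algebraMap F (AdjoinRoot f)))).eval₂
      (eval₂RingHom θ.toRingHom u) v = 0 := by
    rw [eval₂_map, hcomp, huv]
  have hs : ∀ e, AdjoinRoot.lift _ v h0 (secondFactor f e) = θ e := by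
    intro e
    change AdjoinRoot.lift _ v h0 (AdjoinRoot.of _ (C e)) = _
    rw [AdjoinRoot.lift_of]; simp
  refine ⟨{ AdjoinRoot.lift _ v h0 with
    commutes' := fun c => ?_ }, ?_, ?_, hs⟩
  · have := hs (algebraMap F _ c)
    rw [AlgHom.commutes, AlgHom.commutes] at this
    exact this
  · change AdjoinRoot.lift _ v h0 (AdjoinRoot.of _ X) = _
    rw [AdjoinRoot.lift_of]; simp
  · change AdjoinRoot.lift _ v h0 (AdjoinRoot.root _) = _
    rw [AdjoinRoot.lift_root]

lemma firstX_sub_mul_eq_zero (hf : f.Monic) (hirr : Irreducible f) (e : AdjoinRoot f)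
    {a : ProductRing f} (h : (firstX f - secondFactor f e) * a = 0) : a = 0 := by
  have := isDomain_adjoinRoot hirr
  have := (hf.map (mapRingHom (algebraMap F (AdjoinRoot f)))).free_adjoinRoot
  have h1 : (X - C e : (AdjoinRoot f)[X]) • a = 0 := by
    rw [Algebra.smul_def, map_sub]; exact h
  exact (smul_eq_zero_iff_right (X_sub_C_ne_zero e)).1 h1

/-- The auxiliary function on the curve: a nonzero coefficient family `h` for which the
associated function vanishes to high order along the graph of every endomorphism. -/
lemma exists_auxiliary_function (hf : f.Monic) (hirr : Irreducible f) {D : ℕ} (hD : XDegLE f D)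
    (hsep : aeval (AdjoinRoot.root f) (derivative f) ≠ 0)
    (m n A J : ℕ) (hn : n + m * (f.natDegree * D) ≤ A + J)
    (hcard : (A + J) * m * (f.natDegree * f.natDegree) <
      A * f.natDegree * (J * f.natDegree) + m * (n * f.natDegree)) :
    ∃ h : (Fin A × Fin f.natDegree) × (Fin J × Fin f.natDegree) → F, h ≠ 0 ∧
      ∀ θ : AdjoinRoot f →ₐ[F] AdjoinRoot f,
        (algebraMap F[X] (AdjoinRoot f) X - θ (algebraMap F[X] (AdjoinRoot f) X)) ^ m ∣
          (AdjoinRoot.root f - θ (AdjoinRoot.root f)) ^ m *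
            ∑ p, h p • (algebraMap F[X] (AdjoinRoot f) X ^ (p.1.1 : ℕ) *
              AdjoinRoot.root f ^ (p.1.2 : ℕ) *
              θ (algebraMap F[X] (AdjoinRoot f) X ^ (p.2.1 : ℕ) *
                AdjoinRoot.root f ^ (p.2.2 : ℕ))) := by
  have := isDomain_adjoinRoot hirr
  set ξ := algebraMap F[X] (AdjoinRoot f) X with hξ
  set η := AdjoinRoot.root f with hη
  set y : ProductRing f := AdjoinRoot.root _ with hy
  set x := firstX f with hx
  set s := secondFactor f with hs
  have hadd : s ξ + (x - s ξ) = x := add_sub_cancel _ _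
  have hy0 : ∑ i ∈ Finset.range (f.natDegree + 1),
      aeval (s ξ + (x - s ξ)) (f.coeff i) * y ^ i = 0 := by
    rw [hadd, sum_coeff_mul_pow_eq]
    exact eval₂_firstX
  have hZ0 : ∑ i ∈ Finset.range (f.natDegree + 1), aeval (s ξ) (f.coeff i) * s η ^ i = 0 := by
    have h1 := sum_coeff_mul_pow_eq (f := f) ξ η
    rw [eval₂_root] at h1
    have h2 := congrArg s h1
    simpa [aeval_algHom_apply] using h2
  obtain ⟨h, c, hne, hdvd⟩ := exists_auxiliary_relation hf hD hy0 hZ0 m n A J hn hcard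
  rw [hadd] at hdvd
  refine ⟨h, ?_, ?_⟩
  · rintro rfl
    have hc : c ≠ 0 := hne.resolve_left (fun h => h rfl)
    obtain ⟨δ, hδx, hδy, hδs⟩ := exists_productRing_hom (AlgHom.id F _) ξ η eval₂_root
    replace hδx : δ x = ξ := hδx
    replace hδy : δ y = η := hδy
    replace hδs : ∀ e, δ (s e) = e := hδs
    let e : Fin m → AdjoinRoot f := fun l => ∑ p, c (l, p) • (ξ ^ (p.1 : ℕ) * η ^ (p.2 : ℕ))
    have hG : δ (dividedDifference f (s ξ) y (s η) ^ m) ≠ 0 := by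
      rw [map_pow]
      refine pow_ne_zero _ ?_
      convert hsep using 1
      rw [dividedDifference, map_sum, derivative_apply, aeval_def, eval₂_sum, sum_over_range]
      · refine Finset.sum_congr rfl fun i _ => ?_
        simp only [map_mul, map_sum, map_pow, ← aeval_algHom_apply, hδs, hδy, geom_sum₂_self]
        rw [hξ, aeval_algebraMap_X]
        simp [mul_assoc]
      · simp
    have he : e = 0 := by
      refine eq_zero_of_pow_dvd_sum s.toRingHom δ.toRingHom hδs
        (fun _ => firstX_sub_mul_eq_zero hf hirr ξ) ?_ hG m e ?_
      · change δ (x - s ξ) = 0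
        rw [map_sub, hδx, hδs]; exact sub_self _
      · convert hdvd using 1
        simp only [Pi.zero_apply, zero_smul, Finset.sum_const_zero, zero_add]
        congr 1
        rw [Fintype.sum_prod_type]
        refine Finset.sum_congr rfl fun l _ => ?_
        change _ * s (e l) = _
        simp [e, Finset.mul_sum, hx, hs]
    refine hc (funext fun p => ?_)
    exact Fintype.linearIndependent_iff.1 (linearIndependent_monomials hf n) _
      (congrFun he p.1) p.2
  · intro θ
    obtain ⟨Φ, hΦx, hΦy, hΦs⟩ := exists_productRing_hom θ ξ η eval₂_root
    replace hΦx : Φ x = ξ := hΦx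
    replace hΦy : Φ y = η := hΦy
    replace hΦs : ∀ e, Φ (s e) = θ e := hΦs
    have h1 : (x - s ξ) ^ m ∣ (y - s η) ^ m * dividedDifference f (s ξ) y (s η) ^ m := by
      rw [← mul_pow, mul_comm]
      exact pow_dvd_pow_of_dvd (dvd_dividedDifference_mul hy0 hZ0) m
    have h2 := hdvd.mul_left ((y - s η) ^ m)
    rw [mul_add, ← mul_assoc _ (_ ^ m)] at h2
    have h3 := map_dvd Φ ((dvd_add_left (h1.mul_right _)).1 h2)
    simpa [hΦx, hΦy, hΦs, ← mul_assoc] using h3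

end Diagonal
section Multiplicities
variable {F : Type*} [Field F]

lemma prod_sub_algebraMap_eq [Fintype F] {B : Type*} [CommRing B] [Algebra F B] (b : B) :
    ∏ c : F, (b - algebraMap F B c) = b ^ Fintype.card F - b := by
  have hroots := FiniteField.roots_X_pow_card_sub_X F
  have hdeg := FiniteField.X_pow_card_sub_X_natDegree_eq F (Fintype.one_lt_card (α := F))
  have h1 := prod_multiset_X_sub_C_of_monic_of_roots_card_eq
    (p := (X ^ Fintype.card F - X : F[X]))
    (monic_X_pow_sub (by rw [degree_X]; exact_mod_cast Fintype.one_lt_card))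
    (by rw [hroots, hdeg]; rfl)
  rw [hroots] at h1
  have h2 := congrArg (aeval b) h1
  rw [map_sub, map_pow, aeval_X] at h2
  rw [← h2]
  change _ = aeval b (∏ c : F, (X - C c))
  rw [map_prod]
  simp

lemma sum_rootMultiplicity_le_natDegree [Fintype F] (p : F[X]) :
    ∑ x : F, p.rootMultiplicity x ≤ p.natDegree := by
  classical
  simp only [← count_roots]
  rw [Multiset.sum_count_eq_card (fun _ _ => Finset.mem_univ _)]
  exact p.card_roots'

lemma rootMultiplicity_le_natDegree (p : F[X]) (x : F) :
    p.rootMultiplicity x ≤ p.natDegree := by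
  classical
  rw [← count_roots]
  exact (Multiset.count_le_card _ _).trans p.card_roots'

lemma rootMultiplicity_prod {ι : Type*} (s : Finset ι) (p : ι → F[X]) (hp : ∀ i ∈ s, p i ≠ 0)
    (x : F) : (∏ i ∈ s, p i).rootMultiplicity x = ∑ i ∈ s, (p i).rootMultiplicity x := by
  classical
  induction s using Finset.induction_on with
  | empty => simp
  | insert i s hi ih =>
    rw [Finset.prod_insert hi, Finset.sum_insert hi, rootMultiplicity_mul, ih]
    · exact fun j hj => hp j (Finset.mem_insert_of_mem hj)
    · refine mul_ne_zero (hp i (Finset.mem_insert_self _ _)) (Finset.prod_ne_zero_iff.2 ?_)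
      exact fun j hj => hp j (Finset.mem_insert_of_mem hj)

variable {f : F[X][X]}

lemma aeval_root_derivative_ne_zero {a b : F}
    (h0 : f.evalEval a b = 0) (h1 : (derivative f).evalEval a b ≠ 0) :
    aeval (AdjoinRoot.root f) (derivative f) ≠ 0 := by
  intro h
  refine h1 ?_
  rw [AdjoinRoot.aeval_eq, AdjoinRoot.mk_eq_zero] at h
  obtain ⟨g, hg⟩ := h
  rw [hg, evalEval_mul, h0, zero_mul]

lemma mulDegLE_monomial (hf : f.Monic) {D : ℕ} (hD : XDegLE f D) {A a i : ℕ} (ha : a ≤ A)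
    (hi : i ≤ f.natDegree) :
    MulDegLE hf (algebraMap F[X] (AdjoinRoot f) X ^ a * AdjoinRoot.root f ^ i)
      (A + f.natDegree * D) := by
  refine (((mulDegLE_algebraMap hf X).pow a).mul ((mulDegLE_root hf hD).pow i)).mono ?_
  rw [natDegree_X, mul_one]
  exact Nat.add_le_add ha (Nat.mul_le_mul_right _ hi)

variable [Fintype F]

/-- The multiplicity estimate coming from the auxiliary function. -/
lemma mul_card_le_sum_rootMultiplicity (hf : f.Monic) (hirr : Irreducible f) {D : ℕ}
    (hD : XDegLE f D) {a b : F} (h0 : f.evalEval a b = 0)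
    (h1 : (derivative f).evalEval a b ≠ 0) (hconst : ∀ c : F, f.eval (C c) ≠ 0)
    (m n A J : ℕ) (hn : n + m * (f.natDegree * D) ≤ A + J)
    (hcard : (A + J) * m * (f.natDegree * f.natDegree) <
      A * f.natDegree * (J * f.natDegree) + m * (n * f.natDegree))
    (hA : f.natDegree * (A + f.natDegree * D) < Fintype.card F) :
    f.natDegree * m * Fintype.card F ≤
      m * ∑ x : F, ∑ c : F, (f.eval (C c)).rootMultiplicity x +
        f.natDegree * (A + f.natDegree * D + Fintype.card F * (J + f.natDegree * D)) := by
  set q := Fintype.card F with hq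
  set d := f.natDegree with hd
  have := isDomain_adjoinRoot hirr
  have := hf.free_adjoinRoot
  obtain ⟨h, hne, hdvd⟩ := exists_auxiliary_function hf hirr hD
    (aeval_root_derivative_ne_zero h0 h1) m n A J hn hcard
  specialize hdvd (FiniteField.frobeniusAlgHom F (AdjoinRoot f))
  set ξ := algebraMap F[X] (AdjoinRoot f) X with hξ
  set η := AdjoinRoot.root f with hη
  simp only [FiniteField.coe_frobeniusAlgHom, ← hq] at hdvd
  set ψ := ∑ p, h p • (ξ ^ (p.1.1 : ℕ) * η ^ (p.1.2 : ℕ) *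
    (ξ ^ (p.2.1 : ℕ) * η ^ (p.2.2 : ℕ)) ^ q) with hψ
  have hψdeg : MulDegLE hf ψ (A + d * D + q * (J + d * D)) := by
    refine MulDegLE.sum _ fun p _ => MulDegLE.smul ?_ _
    exact (mulDegLE_monomial hf hD p.1.1.2.le p.1.2.2.le).mul
      ((mulDegLE_monomial hf hD p.2.1.2.le p.2.2.2.le).pow q)
  have hψ0 : ψ ≠ 0 := by
    intro hzero
    obtain ⟨ι, hι, hιp⟩ := exists_embedding_powerSeries hf hirr h0 h1
    have hli : ∀ k, LinearIndependent F fun p : Fin k × Fin d =>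
        ι (ξ ^ (p.1 : ℕ) * η ^ (p.2 : ℕ)) := fun k =>
      (linearIndependent_monomials hf k).map' ι.toLinearMap (LinearMap.ker_eq_bot.2 hι)
    have := eq_zero_of_sum_mul_pow_card_eq_zero (hli A) (hli J) ?_ (h := fun i k => h (i, k)) ?_
    · exact hne (funext fun p => congrFun (congrFun this p.1) p.2)
    · intro c hc
      simp only [← map_smul, ← map_sum] at hc ⊢
      rw [X_pow_dvd_embedding hf hirr ι hιp (MulDegLE.sum _ fun p _ =>
        (mulDegLE_monomial hf hD p.1.2.le p.2.2.le).smul _) hA hc, map_zero]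
    · have := congrArg ι hzero
      rw [hψ, Fintype.sum_prod_type] at this
      simpa using this
  set R := Algebra.norm F[X] ψ with hR
  have hR0 : R ≠ 0 := norm_ne_zero hf hirr hψ0
  have hRdeg : R.natDegree ≤ d * (A + d * D + q * (J + d * D)) := natDegree_norm_le hf hψdeg
  set P : F[X] := ∏ c : F, f.eval (C c) with hP
  have hP0 : P ≠ 0 := Finset.prod_ne_zero_iff.2 fun c _ => hconst c
  have hPdvd : η - η ^ q ∣ ∏ c : F, (algebraMap F[X] (AdjoinRoot f) (C c) - η) := by
    have h2 := prod_sub_algebraMap_eq (F := F) η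
    have h3 : ∀ c : F, algebraMap F[X] (AdjoinRoot f) (C c) - η =
        -(η - algebraMap F (AdjoinRoot f) c) := fun c => by
      rw [neg_sub, IsScalarTower.algebraMap_apply F F[X] (AdjoinRoot f)]; rfl
    simp only [h3]
    rw [Finset.prod_neg, h2, ← neg_sub, neg_dvd]
    exact dvd_mul_left _ _
  have hN : (X - X ^ q : F[X]) ^ (d * m) ∣ P ^ m * R := by
    have h2 : (ξ - ξ ^ q) ^ m ∣ (∏ c : F, (algebraMap F[X] (AdjoinRoot f) (C c) - η)) ^ m * ψ :=
      hdvd.trans (mul_dvd_mul_right (pow_dvd_pow_of_dvd hPdvd m) ψ)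
    have h3 := map_dvd (Algebra.norm F[X]) h2
    rw [map_mul, map_pow, map_pow, map_prod] at h3
    simp only [hη, norm_algebraMap_sub_root hf hirr] at h3
    have h4 : ξ - ξ ^ q = algebraMap F[X] (AdjoinRoot f) (X - X ^ q) := by simp [hξ]
    have h5 : Module.finrank F[X] (AdjoinRoot f) = d := (AdjoinRoot.powerBasis' hf).finrank
    rwa [h4, Algebra.norm_algebraMap, h5, ← pow_mul] at h3
  have hmult : ∀ x : F, d * m ≤ m * ∑ c : F, (f.eval (C c)).rootMultiplicity x +
      R.rootMultiplicity x := by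
    intro x
    have h2 : (X - C x) ^ (d * m) ∣ P ^ m * R := by
      refine (pow_dvd_pow_of_dvd ?_ _).trans hN
      rw [dvd_iff_isRoot]
      simp [hq, FiniteField.pow_card]
    have h3 := (le_rootMultiplicity_iff (mul_ne_zero (pow_ne_zero m hP0) hR0)).2 h2
    classical
    rwa [rootMultiplicity_mul (mul_ne_zero (pow_ne_zero m hP0) hR0), ← count_roots (P ^ m),
      roots_pow, Multiset.count_nsmul, count_roots, hP,
      rootMultiplicity_prod _ _ (fun c _ => hconst c)] at h3
  calc d * m * q = ∑ x : F, d * m := by simp [hq, mul_comm]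
    _ ≤ ∑ x : F, (m * ∑ c : F, (f.eval (C c)).rootMultiplicity x + R.rootMultiplicity x) :=
      Finset.sum_le_sum fun x _ => hmult x
    _ ≤ _ := by
      rw [Finset.sum_add_distrib, ← Finset.mul_sum]
      exact Nat.add_le_add_left ((sum_rootMultiplicity_le_natDegree R).trans hRdeg) _

/-- The coefficientwise derivative of a bivariate polynomial with respect to `x`. -/
noncomputable def xDerivative {F : Type*} [Field F] (f : F[X][X]) : F[X][X] :=
  ∑ i ∈ Finset.range (f.natDegree + 1), monomial i (derivative (f.coeff i))

omit [Fintype F] in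
lemma coeff_xDerivative (f : F[X][X]) (i : ℕ) :
    (xDerivative f).coeff i = derivative (f.coeff i) := by
  simp only [xDerivative, finsetSum_coeff, coeff_monomial, Finset.sum_ite_eq', Finset.mem_range]
  split_ifs with h
  · rfl
  · rw [coeff_eq_zero_of_natDegree_lt (by omega), derivative_zero]

omit [Fintype F] in
lemma eval_xDerivative (f : F[X][X]) (c : F) :
    (xDerivative f).eval (C c) = derivative (f.eval (C c)) := by
  rw [eval_eq_sum_range (p := f), derivative_sum, xDerivative, eval_finsetSum]
  refine Finset.sum_congr rfl fun i _ => ?_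
  rw [eval_monomial, ← C_pow, derivative_mul, derivative_C, mul_zero, add_zero]

omit [Fintype F] in
lemma natDegree_eval_C_le {D : ℕ} (hD : XDegLE f D) (c : F) : (f.eval (C c)).natDegree ≤ D := by
  rw [eval_eq_sum_range]
  refine natDegree_sum_le_of_forall_le _ _ fun i _ => ?_
  rw [← C_pow]
  exact (natDegree_mul_C_le _ _).trans (hD i)

omit [Fintype F] in
lemma exists_resultant (hf : f.Monic) (hirr : Irreducible f) {D : ℕ} (hD : XDegLE f D)
    (hx : xDerivative f ≠ 0) :
    ∃ G : F[X], G ≠ 0 ∧ G.natDegree ≤ f.natDegree * (D + f.natDegree * D) ∧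
      ∀ x y, f.evalEval x y = 0 → (xDerivative f).evalEval x y = 0 → G.eval x = 0 := by
  set w := AdjoinRoot.mk f (xDerivative f) with hw
  have hdeg : MulDegLE hf w (D + f.natDegree * D) := by
    rw [hw, xDerivative, map_sum]
    refine MulDegLE.sum _ fun i hi => ?_
    rw [← C_mul_X_pow_eq_monomial, map_mul, map_pow, AdjoinRoot.mk_X, AdjoinRoot.mk_C]
    refine ((mulDegLE_algebraMap hf _).mul ((mulDegLE_root hf hD).pow i)).mono ?_
    exact Nat.add_le_add (((natDegree_derivative_le _).trans (Nat.sub_le _ _)).trans (hD i))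
      (Nat.mul_le_mul_right _ (Nat.lt_succ_iff.1 (Finset.mem_range.1 hi)))
  have hw0 : w ≠ 0 := by
    rw [hw, Ne, AdjoinRoot.mk_eq_zero]
    intro hdvd
    refine hx (eq_zero_of_dvd_of_degree_lt hdvd ?_)
    rw [degree_eq_natDegree hf.ne_zero, degree_lt_iff_coeff_zero]
    intro i hi
    rw [coeff_xDerivative]
    rcases hi.eq_or_lt with rfl | hi
    · rw [hf.coeff_natDegree, derivative_one]
    · rw [coeff_eq_zero_of_natDegree_lt hi, derivative_zero]
  refine ⟨Algebra.norm F[X] w, norm_ne_zero hf hirr hw0, natDegree_norm_le hf hdeg, ?_⟩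
  intro x y h0 h1
  have h2 := map_dvd (AdjoinRoot.evalEval h0) (dvd_algebraMap_norm hf w)
  rw [hw, AdjoinRoot.evalEval_mk, h1, zero_dvd_iff, AdjoinRoot.algebraMap_eq,
    ← AdjoinRoot.mk_C, AdjoinRoot.evalEval_mk, evalEval_C] at h2
  exact h2

omit [Fintype F] in
lemma card_le_of_evalEval_eq_zero (hf : f.Monic) (x : F) (s : Finset F)
    (hs : ∀ y ∈ s, f.evalEval x y = 0) : s.card ≤ f.natDegree := by
  have hm : (f.map (evalRingHom x)).Monic := hf.map _
  refine (card_le_degree_of_subset_roots (p := f.map (evalRingHom x)) ?_).trans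
    (natDegree_map_le)
  intro y hy
  rw [mem_roots hm.ne_zero, IsRoot, eval_map, eval₂_evalRingHom]
  exact hs y hy

open Classical in
lemma sum_rootMultiplicity_le_card (hf : f.Monic) (hirr : Irreducible f) {D : ℕ}
    (hD : XDegLE f D) (hx : xDerivative f ≠ 0) (hconst : ∀ c : F, f.eval (C c) ≠ 0) :
    ∑ x : F, ∑ c : F, (f.eval (C c)).rootMultiplicity x ≤
      (Finset.univ.filter fun p : F × F => f.evalEval p.1 p.2 = 0).card +
        f.natDegree * (D + f.natDegree * D) * f.natDegree * D := by
  obtain ⟨G, hG0, hGdeg, hG⟩ := exists_resultant hf hirr hD hx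
  set S := Finset.univ.filter fun p : F × F =>
    f.evalEval p.1 p.2 = 0 ∧ (xDerivative f).evalEval p.1 p.2 = 0 with hS
  have hScard : S.card ≤ f.natDegree * (D + f.natDegree * D) * f.natDegree := by
    have h1 : S.card ≤ f.natDegree * (S.image Prod.fst).card := by
      refine Finset.card_le_mul_card_image S _ fun x _ => ?_
      rw [← Finset.card_image_of_injOn (f := Prod.snd)]
      · refine card_le_of_evalEval_eq_zero hf x _ fun y hy => ?_
        obtain ⟨p, hp, rfl⟩ := Finset.mem_image.1 hy
        rw [Finset.mem_filter, hS, Finset.mem_filter] at hp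
        rw [← hp.2]; exact hp.1.2.1
      · intro p hp p' hp' h
        simp only [Finset.coe_filter, Set.mem_ofPred_eq] at hp hp'
        exact Prod.ext (hp.2.trans hp'.2.symm) h
    have h2 : (S.image Prod.fst).card ≤ f.natDegree * (D + f.natDegree * D) := by
      refine (card_le_degree_of_subset_roots (p := G) ?_).trans hGdeg
      intro x hx
      obtain ⟨p, hp, rfl⟩ := Finset.mem_image.1 (show x ∈ S.image Prod.fst from hx)
      rw [hS, Finset.mem_filter] at hp
      rw [mem_roots hG0]
      exact hG _ _ hp.2.1 hp.2.2
    calc _ ≤ _ := h1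
      _ ≤ f.natDegree * (f.natDegree * (D + f.natDegree * D)) := Nat.mul_le_mul_left _ h2
      _ = _ := by ring
  have hpt : ∀ p : F × F, (f.eval (C p.2)).rootMultiplicity p.1 ≤
      (if f.evalEval p.1 p.2 = 0 then 1 else 0) + if p ∈ S then D else 0 := by
    intro p
    by_cases h0 : f.evalEval p.1 p.2 = 0
    · by_cases h1 : (xDerivative f).evalEval p.1 p.2 = 0
      · have : p ∈ S := by rw [hS, Finset.mem_filter]; exact ⟨Finset.mem_univ _, h0, h1⟩
        rw [if_pos this]
        exact ((rootMultiplicity_le_natDegree _ _).trans (natDegree_eval_C_le hD _)).trans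
          (Nat.le_add_left _ _)
      · rw [if_pos h0]
        refine le_trans ?_ (Nat.le_add_right _ _)
        by_contra! h2
        refine h1 ?_
        have := ((one_lt_rootMultiplicity_iff_isRoot (hconst p.2)).1 h2).2
        rwa [← eval_xDerivative] at this
    · rw [rootMultiplicity_eq_zero h0]
      exact Nat.zero_le _
  rw [← Fintype.sum_prod_type']
  refine (Finset.sum_le_sum fun p _ => hpt p).trans ?_
  rw [Finset.sum_add_distrib, Finset.card_filter]
  refine Nat.add_le_add_left ?_ _
  rw [← Finset.sum_filter, Finset.sum_const, smul_eq_mul, Finset.filter_mem_eq_inter,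
    Finset.univ_inter]
  exact Nat.mul_le_mul_right _ hScard

end Multiplicities
/-- An admissible choice of parameters in the auxiliary construction. -/
lemma exists_parameters (e D r q : ℕ) (hr : 4 * (e + 1) ^ 3 * (D + 1) < r) (hq : r ^ 2 ≤ q) :
    ∃ A n : ℕ, A ≤ q ∧
      n + (e + 1) * r * ((e + 1) * D) = A + (e * r + (4 * (e + 1) ^ 3 * (D + 1) + 1)) ∧
      (A + (e * r + (4 * (e + 1) ^ 3 * (D + 1) + 1))) * ((e + 1) * r) * ((e + 1) * (e + 1)) <
        A * (e + 1) * ((e * r + (4 * (e + 1) ^ 3 * (D + 1) + 1)) * (e + 1)) +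
          (e + 1) * r * (n * (e + 1)) ∧
      (e + 1) * (A + (e + 1) * D) < q := by
  obtain ⟨d, hd⟩ : ∃ d, d = e + 1 := ⟨_, rfl⟩
  rw [← hd] at hr ⊢
  have hd1 : 1 ≤ d := by omega
  set A := q / (2 * d) with hA
  have hA1 : 2 * d * A ≤ q := Nat.mul_div_le q (2 * d)
  have hA2 : q < 2 * d * (A + 1) := by
    rw [hA]
    exact Nat.lt_mul_div_succ q (by omega)
  clear_value A
  obtain ⟨κ, hκ⟩ : ∃ κ, κ = 4 * d ^ 3 * (D + 1) := ⟨_, rfl⟩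
  rw [← hκ] at hr ⊢
  have hd2 : 1 ≤ d ^ 2 := Nat.one_le_pow _ _ hd1
  have hκd : 4 * d ≤ κ := by
    have : 4 * d * 1 ≤ 4 * d * (d ^ 2 * (D + 1)) :=
      Nat.mul_le_mul_left _ (Nat.mul_pos hd2 D.succ_pos)
    rw [hκ]; linarith [this, show 4 * d * (d ^ 2 * (D + 1)) = 4 * d ^ 3 * (D + 1) by ring]
  have hκD : 4 * (d ^ 2 * D) ≤ κ := by
    have : 4 * (d ^ 2 * D) ≤ 4 * (d ^ 2 * D) * d := Nat.le_mul_of_pos_right _ hd1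
    rw [hκ]; nlinarith
  have h1 : r ^ 2 ≤ 4 * d * A := by nlinarith
  have h2 : r * (d ^ 2 * (D + 1)) ≤ A := by
    have : 4 * d * (r * (d ^ 2 * (D + 1))) ≤ 4 * d * A :=
      calc _ = r * κ := by rw [hκ]; ring
        _ ≤ r * r := Nat.mul_le_mul_left _ hr.le
        _ ≤ _ := by rw [← sq]; exact h1
    exact Nat.le_of_mul_le_mul_left this (by omega)
  have h3 : d * r * (d * D) ≤ A := by
    refine le_trans ?_ h2
    rw [show d * r * (d * D) = r * (d ^ 2 * D) by ring]
    exact Nat.mul_le_mul_left _ (Nat.mul_le_mul_left _ D.le_succ)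
  have hqr : r ≤ q := by nlinarith
  obtain ⟨n, hn⟩ : ∃ n, n + d * r * (d * D) = A + (e * r + (κ + 1)) :=
    ⟨A + (e * r + (κ + 1)) - d * r * (d * D), Nat.sub_add_cancel (h3.trans (Nat.le_add_right _ _))⟩
  refine ⟨A, n, by nlinarith, hn, ?_, by nlinarith⟩
  have h4 : r ^ 2 * (d ^ 2 * (D + 1)) ≤ A * κ := by
    calc r ^ 2 * (d ^ 2 * (D + 1)) ≤ 4 * d * A * (d ^ 2 * (D + 1)) := Nat.mul_le_mul_right _ h1
      _ = A * κ := by rw [hκ]; ring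
  have h5 : e * r * (κ + 1) ≤ e * r * r := Nat.mul_le_mul_left _ hr
  have h6 : (e * r + (κ + 1)) * (e * r) + d ^ 2 * r ^ 2 * D < A * (κ + 1) := by
    have h7 : d ^ 2 = e ^ 2 + 2 * e + 1 := by rw [hd]; ring
    have h8 : 0 < r ^ 2 := pow_pos (by omega) 2
    have h9 : r ^ 2 * (d ^ 2 * (D + 1)) = d ^ 2 * r ^ 2 * D + (e ^ 2 + 2 * e + 1) * r ^ 2 := by
      rw [← h7]; ring
    nlinarith [Nat.zero_le A, Nat.zero_le (e * r ^ 2)]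
  have h7 : (A + (e * r + (κ + 1))) * (d * r) * (d * d) + d * d * r * (d * r * (d * D)) <
      A * d * ((e * r + (κ + 1)) * d) + d * r * (n * d) + d * d * r * (d * r * (d * D)) := by
    have h8 : d * r * (n * d) + d * d * r * (d * r * (d * D)) =
        d * d * r * (A + (e * r + (κ + 1))) := by rw [← hn]; ring
    rw [add_assoc, h8]
    have h9 := Nat.mul_lt_mul_of_pos_left h6 (show 0 < d * d by positivity)
    have h10 : (A + (e * r + (κ + 1))) * (d * r) * (d * d) =
        d * d * ((A + (e * r + (κ + 1))) * (e * r)) + d * d * r * (A + (e * r + (κ + 1))) := by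
      rw [show d * r = e * r + r by rw [hd]; ring]; ring
    rw [h10]
    nlinarith
  exact Nat.lt_of_add_lt_add_right h7

section PointCount

lemma eval_C_ne_zero_of_irreducible {F : Type*} [Field F] {f : F[X][X]} (hf : f.Monic)
    (hirr : Irreducible f) (hx : xDerivative f ≠ 0) (c : F) : f.eval (C c) ≠ 0 := by
  intro h
  have hass : Associated (X - C (C c)) f :=
    (irreducible_X_sub_C _).associated_of_dvd hirr (dvd_iff_isRoot.2 h)
  have heq : X - C (C c) = f := eq_of_monic_of_associated (monic_X_sub_C _) hf hass
  refine hx ?_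
  ext1 i
  rw [coeff_xDerivative, ← heq, coeff_sub, coeff_X, coeff_C, coeff_zero]
  split_ifs <;> simp

open Classical in
lemma exists_card_le_of_irreducible (d D : ℕ) : ∃ K : ℕ, ∀ (F : Type) [Field F] [Fintype F]
    (f : F[X][X]), f.Monic → Irreducible f → f.natDegree = d → XDegLE f D → xDerivative f ≠ 0 →
    ∀ a b : F, f.evalEval a b = 0 → (derivative f).evalEval a b ≠ 0 →
      Fintype.card F ≤ (Finset.univ.filter fun p : F × F => f.evalEval p.1 p.2 = 0).card +
        K * Nat.sqrt (Fintype.card F) := by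
  set κ := 4 * d ^ 3 * (D + 1) with hκ
  set K₁ := d * (D + d * D) * d * D with hK₁
  refine ⟨3 * κ + (K₁ + 3 * (2 + 2 * (d * D) + κ)), ?_⟩
  intro F _ _ f hf hirr hd hD hx a b h0 h1
  set q := Fintype.card F with hq
  set N := (Finset.univ.filter fun p : F × F => f.evalEval p.1 p.2 = 0).card with hN
  set r := Nat.sqrt q with hr
  have hrq : r ^ 2 ≤ q := Nat.sqrt_le' q
  have hqr : q < (r + 1) ^ 2 := Nat.lt_succ_sqrt' q
  have hq1 : 1 ≤ q := Fintype.card_pos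
  have hr1 : 1 ≤ r := Nat.sqrt_pos.2 hq1
  have hq3 : q ≤ 3 * r ^ 2 := by nlinarith
  rcases Nat.lt_or_ge κ r with hlarge | hsmall
  · have hd0 : d ≠ 0 := by
      rintro rfl
      rw [hf.natDegree_eq_zero] at hd
      exact hirr.not_isUnit (hd ▸ isUnit_one)
    obtain ⟨e, rfl⟩ := Nat.exists_eq_succ_of_ne_zero hd0
    obtain ⟨A, n, hAq, hn, hcard, hA⟩ := exists_parameters e D r q hlarge hrq
    have hmain := mul_card_le_sum_rootMultiplicity hf hirr hD h0 h1
      (eval_C_ne_zero_of_irreducible hf hirr hx) ((e + 1) * r) n A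
      (e * r + (κ + 1)) (by rw [hd]; exact hn.le) (by rw [hd]; exact hcard)
      (by rw [hd]; exact hA)
    have hsum := sum_rootMultiplicity_le_card hf hirr hD hx
      (eval_C_ne_zero_of_irreducible hf hirr hx)
    rw [hd] at hmain hsum
    rw [← hq] at hmain
    replace hsum := show _ ≤ N + K₁ from hsum
    clear_value κ K₁ N
    have h2 : r * q ≤ r * (N + K₁ + 3 * r * (2 + 2 * ((e + 1) * D) + κ)) := by
      have h3 : (e + 1) * r * q ≤ r * (N + K₁) + (A + (e + 1) * D +
          q * (e * r + (κ + 1) + (e + 1) * D)) := by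
        refine Nat.le_of_mul_le_mul_left (le_trans (le_of_eq ?_)
          (hmain.trans (le_trans (Nat.add_le_add_right (Nat.mul_le_mul_left _ hsum) _)
            (le_of_eq ?_)))) (Nat.succ_pos e)
        · simp only [Nat.succ_eq_add_one]; ring
        · simp only [Nat.succ_eq_add_one]; ring
      have h4 : (e + 1) * D * 1 ≤ (e + 1) * D * q := Nat.mul_le_mul_left _ hq1
      have h5 : q * (2 + 2 * ((e + 1) * D) + κ) ≤
          3 * r ^ 2 * (2 + 2 * ((e + 1) * D) + κ) := Nat.mul_le_mul_right _ hq3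
      linarith
    have h3 := Nat.le_of_mul_le_mul_left h2 hr1
    have h4 : K₁ * 1 ≤ K₁ * r := Nat.mul_le_mul_left _ hr1
    calc q ≤ N + K₁ + 3 * r * (2 + 2 * ((e + 1) * D) + κ) := h3
      _ ≤ N + (K₁ + 3 * (2 + 2 * ((e + 1) * D) + κ)) * r := by linarith
      _ ≤ _ := Nat.add_le_add_left (Nat.mul_le_mul_right _ (Nat.le_add_left _ _)) _
  · calc q ≤ 3 * r ^ 2 := hq3
      _ = 3 * r * r := by ring
      _ ≤ 3 * κ * r := Nat.mul_le_mul_right _ (Nat.mul_le_mul_left _ hsmall)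
      _ ≤ _ := by nlinarith [Nat.zero_le N, Nat.zero_le ((K₁ + 3 * (2 + 2 * (d * D) + κ)) * r)]

end PointCount
section Reduction
variable {F : Type*} [Field F]

lemma xDegLE_iff_natDegree_swap_le {f : F[X][X]} {D : ℕ} :
    XDegLE f D ↔ (Bivariate.swap f).natDegree ≤ D := by
  have key : ∀ (f : F[X][X]) (i j : ℕ), ((Bivariate.swap f).coeff j).coeff i =
      (f.coeff i).coeff j := by
    intro f i j
    induction f using Polynomial.induction_on' with
    | add p q hp hq => simp [hp, hq]
    | monomial n p =>
      rw [Bivariate.swap_monomial, coeff_mul_C, coeff_map, coeff_C_mul, coeff_X_pow,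
        coeff_monomial]
      simp only [eq_comm (a := i)]
      split_ifs <;> simp
  simp only [XDegLE, natDegree_le_iff_coeff_eq_zero]
  constructor
  · intro h j hj
    ext i
    rw [key, h i j hj, coeff_zero]
  · intro h i j hj
    rw [← key, h j hj, coeff_zero]

lemma XDegLE.of_mul {f g : F[X][X]} (hg : g ≠ 0) {D : ℕ} (h : XDegLE (f * g) D) : XDegLE f D := by
  rcases eq_or_ne f 0 with rfl | hf
  · intro i; simp
  rw [xDegLE_iff_natDegree_swap_le, map_mul, natDegree_mul] at h
  · exact xDegLE_iff_natDegree_swap_le.2 (le_trans (Nat.le_add_right _ _) h)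
  · simpa using hf
  · simpa using hg

lemma exists_irreducible_dvd_of_evalEval_eq_zero {a b : F} (n : ℕ) :
    ∀ f : F[X][X], f.natDegree = n → f.Monic → f.evalEval a b = 0 →
      ∃ f₁ g : F[X][X], f₁.Monic ∧ Irreducible f₁ ∧ f = f₁ * g ∧ f₁.evalEval a b = 0 := by
  induction n using Nat.strong_induction_on with
  | _ n ih =>
    intro f hn hf h0
    by_cases hirr : Irreducible f
    · exact ⟨f, 1, hf, hirr, (mul_one f).symm, h0⟩
    have hf1 : f ≠ 1 := by
      rintro rfl
      simp [evalEval] at h0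
    rw [hf.irreducible_iff_natDegree, not_and] at hirr
    have := hirr hf1
    push Not at this
    obtain ⟨p, r, hp, hr, hpr, hp0, hr0⟩ := this
    have hdeg : p.natDegree + r.natDegree = n := by rw [← hp.natDegree_mul hr, hpr, hn]
    rw [← hpr, evalEval_mul, mul_eq_zero] at h0
    rcases h0 with h0 | h0
    · obtain ⟨f₁, g, h1, h2, h3, h4⟩ := ih p.natDegree (by omega) p rfl hp h0
      exact ⟨f₁, g * r, h1, h2, by rw [← hpr, h3, mul_assoc], h4⟩
    · obtain ⟨f₁, g, h1, h2, h3, h4⟩ := ih r.natDegree (by omega) r rfl hr h0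
      exact ⟨f₁, g * p, h1, h2, by rw [← hpr, h3]; ring, h4⟩

lemma evalEval_taylor_X (f : F[X][X]) (x y : F) :
    (taylor X f).evalEval x y = f.evalEval x (y + x) := by
  rw [evalEval, taylor_eval, ← eval₂_evalRingHom, ← coe_evalRingHom x, eval, hom_eval₂]
  simp

lemma derivative_eval_add (f : F[X][X]) (p : F[X]) :
    derivative (f.eval p) = (xDerivative f).eval p + (derivative f).eval p * derivative p := by
  induction f using Polynomial.induction_on' with
  | add f g hf hg =>
    have : xDerivative (f + g) = xDerivative f + xDerivative g := by
      ext1 i; simp [coeff_xDerivative]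
    rw [this, eval_add, derivative_add, hf, hg, derivative_add, eval_add, eval_add]
    ring
  | monomial n r =>
    have : xDerivative (monomial n r) = monomial n (derivative r) := by
      ext1 i
      rw [coeff_xDerivative, coeff_monomial, coeff_monomial]
      split_ifs <;> simp
    rw [this, eval_monomial, eval_monomial, derivative_monomial, eval_monomial, derivative_mul,
      derivative_pow, C_eq_natCast]
    ring

lemma XDegLE.taylor_X {f : F[X][X]} {D : ℕ} (h : XDegLE f D) :
    XDegLE (taylor X f) (D + f.natDegree) := by
  rw [xDegLE_iff_natDegree_swap_le, taylor_apply, comp, eval₂_eq_sum_range, map_sum]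
  refine natDegree_sum_le_of_forall_le _ _ fun i hi => ?_
  rw [map_mul, map_pow, map_add, Bivariate.swap_X, Bivariate.swap_Y, Bivariate.swap_C]
  refine natDegree_mul_le_of_le (natDegree_map_le.trans (h i)) ?_
  have hlin : (C X + X : F[X][X]).natDegree ≤ 1 := by
    rw [add_comm]
    exact (natDegree_X_add_C _).le
  refine (natDegree_pow_le_of_le i hlin).trans ?_
  have := Finset.mem_range.1 hi
  omega

end Reduction

section
open Classical

lemma exists_card_le_of_irreducible' (d D : ℕ) : ∃ K : ℕ, ∀ (F : Type) [Field F] [Fintype F]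
    (f : F[X][X]), f.Monic → Irreducible f → f.natDegree = d → XDegLE f D →
    ∀ a b : F, f.evalEval a b = 0 → (derivative f).evalEval a b ≠ 0 →
      Fintype.card F ≤ (Finset.univ.filter fun p : F × F => f.evalEval p.1 p.2 = 0).card +
        K * Nat.sqrt (Fintype.card F) := by
  obtain ⟨K₁, hK₁⟩ := exists_card_le_of_irreducible d D
  obtain ⟨K₂, hK₂⟩ := exists_card_le_of_irreducible d (D + d)
  refine ⟨K₁ + K₂, fun F _ _ f hf hirr hd hD a b h0 h1 => ?_⟩
  by_cases hx : xDerivative f = 0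
  · have hx' : xDerivative (taylor X f) ≠ 0 := by
      intro h
      have h2 := eval_xDerivative (taylor X f) (b - a)
      rw [h, eval_zero, taylor_eval, derivative_eval_add, hx, eval_zero, zero_add, derivative_add,
        derivative_C, derivative_X, zero_add, mul_one, ← taylor_eval] at h2
      have h3 := evalEval_taylor_X (derivative f) a (b - a)
      rw [evalEval, ← h2, eval_zero, sub_add_cancel] at h3
      exact h1 h3.symm
    have hder : derivative (taylor X f) = taylor X (derivative f) := by
      rw [taylor_apply, taylor_apply, derivative_comp]
      simp
    have hmain := hK₂ F (taylor X f) (by rw [Monic, leadingCoeff_taylor, hf])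
      (((MulEquiv.irreducible_iff (taylorEquiv (X : F[X]))).2 hirr :))
      (by rw [natDegree_taylor, hd]) (hd ▸ hD.taylor_X) hx' a (b - a)
      (by rw [evalEval_taylor_X, sub_add_cancel, h0])
      (by rwa [hder, evalEval_taylor_X, sub_add_cancel])
    have hcard : (Finset.univ.filter fun p : F × F => (taylor X f).evalEval p.1 p.2 = 0).card ≤
        (Finset.univ.filter fun p : F × F => f.evalEval p.1 p.2 = 0).card := by
      refine Finset.card_le_card_of_injOn (fun p => (p.1, p.2 + p.1)) ?_ ?_
      · intro p hp
        simpa [evalEval_taylor_X] using hp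
      · rintro ⟨x, y⟩ - ⟨x', y'⟩ - h
        simp only [Prod.mk.injEq] at h
        obtain ⟨rfl, h⟩ := h
        rw [add_left_inj] at h
        rw [h]
    rw [add_mul]
    omega
  · have := hK₁ F f hf hirr hd hD hx a b h0 h1
    rw [add_mul]
    omega

/-- A monic plane curve of bounded degree with a smooth rational point has at least
`q - O(√q)` rational points. -/
theorem exists_card_le_of_smooth (d D : ℕ) : ∃ K : ℕ, ∀ (F : Type) [Field F] [Fintype F]
    (f : F[X][X]), f.Monic → f.natDegree ≤ d → XDegLE f D →
    ∀ a b : F, f.evalEval a b = 0 → (derivative f).evalEval a b ≠ 0 →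
      Fintype.card F ≤ (Finset.univ.filter fun p : F × F => f.evalEval p.1 p.2 = 0).card +
        K * Nat.sqrt (Fintype.card F) := by
  choose K hK using fun d => exists_card_le_of_irreducible' d D
  refine ⟨∑ i ∈ Finset.range (d + 1), K i, fun F _ _ f hf hd hD a b h0 h1 => ?_⟩
  obtain ⟨f₁, g, hf₁, hirr, rfl, h2⟩ := exists_irreducible_dvd_of_evalEval_eq_zero _ f rfl hf h0
  have hg : g.Monic := hf₁.of_mul_monic_left hf
  rw [derivative_mul, evalEval_add, evalEval_mul, evalEval_mul, h2, zero_mul, add_zero] at h1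
  have hmain := hK f₁.natDegree F f₁ hf₁ hirr rfl (hD.of_mul hg.ne_zero) a b h2
    (left_ne_zero_of_mul h1)
  rw [hf₁.natDegree_mul hg] at hd
  refine hmain.trans (Nat.add_le_add (Finset.card_le_card ?_) (Nat.mul_le_mul_right _ ?_))
  · intro p hp
    simp only [Finset.mem_filter, Finset.mem_univ, true_and] at hp ⊢
    rw [evalEval_mul, hp, zero_mul]
  · exact Finset.single_le_sum (f := K) (fun _ _ => Nat.zero_le _)
      (Finset.mem_range.2 (by omega))

end
/-- A finite separable extension of the fraction field of an integrally closed domain `R` has a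
primitive element with a minimal polynomial over `R`, and finitely many elements of the extension
can be written with a common denominator from `R`. -/
lemma exists_integral_primitive_element (R E : Type*) {L : Type*} [CommRing R] [IsDomain R]
    [IsIntegrallyClosed R] [Field E] [Algebra R E] [IsFractionRing R E] [Field L] [Algebra R L]
    [Algebra E L] [IsScalarTower R E L] [FiniteDimensional E L] [Algebra.IsSeparable E L]
    (ι : Type*) [Fintype ι] :
    ∃ (f : R[X]) (y : L), f.Monic ∧ (∀ p : R[X], aeval y p = 0 → f ∣ p) ∧
      aeval y f = 0 ∧ aeval y (derivative f) ≠ 0 ∧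
      ∀ z : ι → L, ∃ (a : ι → R[X]) (b : R), b ≠ 0 ∧
        ∀ i, algebraMap R L b * z i = aeval y (a i) := by
  classical
  have hinj : Function.Injective (algebraMap R L) := by
    rw [IsScalarTower.algebraMap_eq R E L]
    exact (algebraMap E L).injective.comp (IsFractionRing.injective R E)
  have : FaithfulSMul R L := (faithfulSMul_iff_algebraMap_injective R L).2 hinj
  obtain ⟨α, hα⟩ := Field.exists_primitive_element E L
  have halg : IsAlgebraic R α :=
    (IsFractionRing.isAlgebraic_iff R E L).2 (Algebra.IsAlgebraic.isAlgebraic α)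
  obtain ⟨r, hr, h_int⟩ := halg.exists_integral_multiple
  have hy : IntermediateField.adjoin E {r • α} = ⊤ := by
    rw [eq_top_iff, ← hα, IntermediateField.adjoin_simple_le_iff]
    have h1 : r • α ∈ IntermediateField.adjoin E {r • α} :=
      IntermediateField.mem_adjoin_simple_self E _
    have h2 := IntermediateField.smul_mem _ h1 (x := (algebraMap R E r)⁻¹)
    rw [← algebraMap_smul E r α, smul_smul, inv_mul_cancel₀, one_smul, algebraMap_smul] at h2
    · exact h2
    exact fun h => hr (IsFractionRing.injective R E (h.trans (map_zero _).symm))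
  set y := r • α
  have hmin := minpoly.isIntegrallyClosed_eq_field_fractions' E h_int
  have hrep : ∀ z : L, ∃ (a : R[X]) (b : R), b ≠ 0 ∧ algebraMap R L b * z = aeval y a := by
    intro z
    have hz : z ∈ Algebra.adjoin E {y} := by
      rw [← IntermediateField.adjoin_simple_toSubalgebra_of_isAlgebraic
        (Algebra.IsAlgebraic.isAlgebraic y), hy]
      trivial
    rw [Algebra.adjoin_singleton_eq_range_aeval] at hz
    obtain ⟨p, hp⟩ := hz
    obtain ⟨b, hb, hbp⟩ := IsLocalization.integerNormalization_spec (nonZeroDivisors R) p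
    refine ⟨IsLocalization.integerNormalization (nonZeroDivisors R) p, b,
      nonZeroDivisors.ne_zero hb, ?_⟩
    rw [← aeval_map_algebraMap E, hbp, ← algebraMap_smul E b p, map_smul, ← hp,
      algebraMap_smul, Algebra.smul_def]
    rfl
  choose a b hb hab using hrep
  refine ⟨minpoly R y, y, minpoly.monic h_int, fun p hp => minpoly.isIntegrallyClosed_dvd h_int hp,
    minpoly.aeval R y, ?_, fun z =>
      ⟨fun i => C (∏ j ∈ Finset.univ.erase i, b (z j)) * a (z i), ∏ i, b (z i),
        Finset.prod_ne_zero_iff.2 fun i _ => hb _, fun i => ?_⟩⟩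
  · have h1 := (Algebra.IsSeparable.isSeparable E y).aeval_derivative_ne_zero (minpoly.aeval E y)
    rwa [hmin, derivative_map, aeval_map_algebraMap] at h1
  · rw [← Finset.mul_prod_erase _ _ (Finset.mem_univ i), map_mul]
    simp only [map_mul, aeval_C, ← hab (z i)]
    ring

lemma exists_eval₂_eq_mul_pow {k B L M σ : Type*} [CommRing k] [CommRing B] [Field L] [Field M]
    (φ : k →+* B) (ψ : B →+* L) (θ : B →+* M) {b : B} (hψ : ψ b ≠ 0) (hθ : θ b ≠ 0) (a : σ → B)
    (H : MvPolynomial σ k) :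
    ∃ (h : B) (n : ℕ),
      ψ h = ψ b ^ n * MvPolynomial.eval₂ (ψ.comp φ) (fun j => ψ (a j) / ψ b) H ∧
      θ h = θ b ^ n * MvPolynomial.eval₂ (θ.comp φ) (fun j => θ (a j) / θ b) H := by
  induction H using MvPolynomial.induction_on with
  | C c => exact ⟨φ c, 0, by simp, by simp⟩
  | add p q hp hq =>
    obtain ⟨h₁, n₁, h1, h2⟩ := hp
    obtain ⟨h₂, n₂, h3, h4⟩ := hq
    refine ⟨b ^ n₂ * h₁ + b ^ n₁ * h₂, n₁ + n₂, ?_, ?_⟩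
    · rw [map_add, map_mul, map_mul, map_pow, map_pow, h1, h3, MvPolynomial.eval₂_add]; ring
    · rw [map_add, map_mul, map_mul, map_pow, map_pow, h2, h4, MvPolynomial.eval₂_add]; ring
  | mul_X p j hp =>
    obtain ⟨h, n, h1, h2⟩ := hp
    refine ⟨h * a j, n + 1, ?_, ?_⟩
    · rw [map_mul, h1, MvPolynomial.eval₂_mul, MvPolynomial.eval₂_X]; field_simp; ring
    · rw [map_mul, h2, MvPolynomial.eval₂_mul, MvPolynomial.eval₂_X]; field_simp; ring

section Specialization
variable {k B L M σ : Type*} [CommRing k] [CommRing B] [Field L] [Field M]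
    (φ : k →+* B) {ψ : B →+* L} {θ : B →+* M} {b : B} (hψ : ψ b ≠ 0) (hθ : θ b ≠ 0) {a : σ → B}
    (hinj : Function.Injective ψ)
include hψ hθ hinj

lemma eval₂_eq_zero_of_specialization {H : MvPolynomial σ k}
    (hH : MvPolynomial.eval₂ (ψ.comp φ) (fun j => ψ (a j) / ψ b) H = 0) :
    MvPolynomial.eval₂ (θ.comp φ) (fun j => θ (a j) / θ b) H = 0 := by
  obtain ⟨h, n, h1, h2⟩ := exists_eval₂_eq_mul_pow φ ψ θ hψ hθ a H
  rw [hH, mul_zero, ← map_zero ψ] at h1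
  rw [hinj h1, map_zero, eq_comm, mul_eq_zero] at h2
  exact h2.resolve_left (pow_ne_zero _ hθ)

lemma eval₂_ne_zero_of_specialization {H : MvPolynomial σ k} {w : B}
    (hw : MvPolynomial.eval₂ (ψ.comp φ) (fun j => ψ (a j) / ψ b) H * ψ w = ψ b) :
    MvPolynomial.eval₂ (θ.comp φ) (fun j => θ (a j) / θ b) H ≠ 0 := by
  obtain ⟨h, n, h1, h2⟩ := exists_eval₂_eq_mul_pow φ ψ θ hψ hθ a H
  intro h0
  have h3 : ψ (h * w) = ψ (b ^ (n + 1)) := by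
    rw [map_mul, h1, mul_assoc, hw, map_pow, pow_succ]
  have h4 := congrArg θ (hinj h3)
  rw [map_mul, h2, h0, mul_zero, zero_mul, map_pow] at h4
  exact pow_ne_zero _ hθ h4.symm

lemma eval₂_mul_eq_of_specialization {H H' : MvPolynomial σ k} {x : B}
    (hx : MvPolynomial.eval₂ (ψ.comp φ) (fun j => ψ (a j) / ψ b) H * ψ x =
      MvPolynomial.eval₂ (ψ.comp φ) (fun j => ψ (a j) / ψ b) H') :
    MvPolynomial.eval₂ (θ.comp φ) (fun j => θ (a j) / θ b) H * θ x =
      MvPolynomial.eval₂ (θ.comp φ) (fun j => θ (a j) / θ b) H' := by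
  obtain ⟨h, n, h1, h2⟩ := exists_eval₂_eq_mul_pow φ ψ θ hψ hθ a H
  obtain ⟨h', n', h1', h2'⟩ := exists_eval₂_eq_mul_pow φ ψ θ hψ hθ a H'
  have h3 : ψ (h * x * b ^ n') = ψ (h' * b ^ n) := by
    simp only [map_mul, map_pow, h1, h1', ← hx]; ring
  have h4 := congrArg θ (hinj h3)
  simp only [map_mul, map_pow, h2, h2'] at h4
  have h5 := mul_ne_zero (pow_ne_zero n hθ) (pow_ne_zero n' hθ)
  apply mul_left_cancel₀ h5
  linear_combination h4

end Specialization

open IntermediateField in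
lemma exists_integral_primitive_element_of_transcendental {k L : Type*} [Field k] [Field L]
    [Algebra k L] {x₀ : L} (hx₀ : Transcendental k x₀) [FiniteDimensional k⟮x₀⟯ L]
    [Algebra.IsSeparable k⟮x₀⟯ L] (ι : Type*) [Fintype ι] :
    ∃ (f : k[X][X]) (y : L), f.Monic ∧
      (∀ p : k[X][X], eval₂ (eval₂RingHom (algebraMap k L) x₀) y p = 0 → f ∣ p) ∧
      eval₂ (eval₂RingHom (algebraMap k L) x₀) y f = 0 ∧
      eval₂ (eval₂RingHom (algebraMap k L) x₀) y (derivative f) ≠ 0 ∧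
      ∀ z : ι → L, ∃ (a : ι → k[X][X]) (b : k[X]), eval₂ (algebraMap k L) x₀ b ≠ 0 ∧
        ∀ i, eval₂ (algebraMap k L) x₀ b * z i =
        eval₂ (eval₂RingHom (algebraMap k L) x₀) y (a i) := by
  let : Algebra k[X] L := (eval₂RingHom (algebraMap k L) x₀).toAlgebra
  let : Algebra k[X] k⟮x₀⟯ := (aeval (AdjoinSimple.gen k x₀)).toRingHom.toAlgebra
  have htower : ∀ p : k[X], algebraMap k[X] L p = algebraMap k⟮x₀⟯ L (algebraMap k[X] k⟮x₀⟯ p) := by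
    intro p
    change aeval x₀ p = algebraMap k⟮x₀⟯ L (aeval (AdjoinSimple.gen k x₀) p)
    rw [← aeval_algebraMap_apply, AdjoinSimple.algebraMap_gen]
  have : IsScalarTower k[X] k⟮x₀⟯ L := IsScalarTower.of_algebraMap_eq htower
  have hinjL : Function.Injective (algebraMap k[X] L) :=
    transcendental_iff_injective.1 hx₀
  have hinj : Function.Injective (algebraMap k[X] k⟮x₀⟯) := by
    intro p q hpq
    exact hinjL (by rw [htower, htower, hpq])
  have : FaithfulSMul k[X] k⟮x₀⟯ := (faithfulSMul_iff_algebraMap_injective _ _).2 hinj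
  have : IsFractionRing k[X] k⟮x₀⟯ := IsFractionRing.of_field _ _ fun z => by
    obtain ⟨r, s, h⟩ := (mem_adjoin_simple_iff k (z : L)).1 z.2
    refine ⟨r, s, Subtype.ext ?_⟩
    rw [h]
    change algebraMap k[X] L r / algebraMap k[X] L s = _
    rw [htower, htower, ← map_div₀]
    rfl
  obtain ⟨f, y, h1, h2, h3, h4, h5⟩ :=
    exists_integral_primitive_element k[X] k⟮x₀⟯ (L := L) ι
  refine ⟨f, y, h1, h2, h3, h4, fun z => ?_⟩
  obtain ⟨a, b, h6, h7⟩ := h5 z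
  exact ⟨a, b, fun h => h6 (hinjL (h.trans (map_zero _).symm)), h7⟩

open IntermediateField in
lemma exists_separable_simple_transcendental {k₀ L : Type*} [Field k₀] [PerfectField k₀] [Field L]
    [Algebra k₀ L] [Algebra.EssFiniteType k₀ L] (hL : ¬ Algebra.IsAlgebraic k₀ L) :
    ∃ (k : IntermediateField k₀ L) (x₀ : L), Transcendental k x₀ ∧
      FiniteDimensional k⟮x₀⟯ L ∧ Algebra.IsSeparable k⟮x₀⟯ L := by
  obtain ⟨s, hs, hsep⟩ := exists_isTranscendenceBasis_and_isSeparable_of_perfectField (k := k₀)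
    (K := L)
  have hne : s.Nonempty := by
    rw [Finset.nonempty_iff_ne_empty]
    rintro rfl
    have : IsEmpty {x : L // x ∈ (∅ : Finset L)} := ⟨fun x => Finset.notMem_empty _ x.2⟩
    exact hL (hs.isEmpty_iff_isAlgebraic.1 this)
  obtain ⟨x₀, hx₀⟩ := hne
  set k := adjoin k₀ ((s : Set L) \ {x₀}) with hk
  have hle : adjoin k₀ (s : Set L) ≤ k⟮x₀⟯.restrictScalars k₀ := by
    rw [hk, adjoin_adjoin_left]
    refine adjoin.mono _ _ _ ?_
    intro z hz
    by_cases h : z = x₀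
    · exact Or.inr h
    · exact Or.inl ⟨hz, h⟩
  let : Algebra (adjoin k₀ (s : Set L)) k⟮x₀⟯ := (inclusion hle).toRingHom.toAlgebra
  have : IsScalarTower (adjoin k₀ (s : Set L)) k⟮x₀⟯ L :=
    IsScalarTower.of_algebraMap_eq fun _ => rfl
  have : Algebra.IsSeparable k⟮x₀⟯ L :=
    Algebra.isSeparable_tower_top_of_isSeparable (adjoin k₀ (s : Set L)) k⟮x₀⟯ L
  have : Algebra.EssFiniteType k L := Algebra.EssFiniteType.of_comp k₀ k L
  have : Algebra.EssFiniteType k⟮x₀⟯ L := Algebra.EssFiniteType.of_comp k k⟮x₀⟯ L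
  refine ⟨k, x₀, ?_, Algebra.finite_of_essFiniteType_of_isAlgebraic, inferInstance⟩
  rw [Transcendental, hk, isAlgebraic_adjoin_iff]
  have h1 := hs.1.transcendental_adjoin (s := {⟨x₀, hx₀⟩}ᶜ) (i := ⟨x₀, hx₀⟩) (by simp)
  have himg : (Subtype.val '' ({⟨x₀, hx₀⟩}ᶜ : Set s)) = (s : Set L) \ {x₀} := by
    ext z
    simp only [Set.mem_image, Set.mem_compl_iff, Set.mem_singleton_iff, Subtype.exists,
      Subtype.mk.injEq, Set.mem_sdiff, Finset.mem_coe]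
    constructor
    · rintro ⟨a, ha, hne, rfl⟩; exact ⟨ha, hne⟩
    · rintro ⟨ha, hne⟩; exact ⟨z, ha, hne, rfl⟩
  rw [himg] at h1
  exact h1

open IntermediateField in
lemma exists_curve_model_of_transcendental {k₀ k L K : Type*} [Field k₀] [Field k] [Field L]
    [Field K] [Algebra k L] {x₀ : L} (hx₀ : Transcendental k x₀) [FiniteDimensional k⟮x₀⟯ L]
    [Algebra.IsSeparable k⟮x₀⟯ L] (ι : k₀ →+* k) (τ : L →+* K) {t : ℕ} (p : Fin t → L)
    (hgen : ∀ z : L, ∃ r s : MvPolynomial (Fin t) k₀,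
      MvPolynomial.eval₂ ((algebraMap k L).comp ι) p s ≠ 0 ∧
      MvPolynomial.eval₂ ((algebraMap k L).comp ι) p s * z =
        MvPolynomial.eval₂ ((algebraMap k L).comp ι) p r)
    {G : MvPolynomial (Fin t) k₀} (hG : MvPolynomial.eval₂ ((algebraMap k L).comp ι) p G ≠ 0) :
    ∃ (f : K[X][X]) (A : Fin t → K[X][X]) (b : K[X]) (x y : K), f.Monic ∧
      f.evalEval x y = 0 ∧ (derivative f).evalEval x y ≠ 0 ∧ b.eval x ≠ 0 ∧
      (∀ x y, f.evalEval x y = 0 → b.eval x ≠ 0 →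
        (∀ H, MvPolynomial.eval₂ ((algebraMap k L).comp ι) p H = 0 →
          MvPolynomial.eval₂ (τ.comp ((algebraMap k L).comp ι))
            (fun j => (A j).evalEval x y / b.eval x) H = 0) ∧
        MvPolynomial.eval₂ (τ.comp ((algebraMap k L).comp ι))
            (fun j => (A j).evalEval x y / b.eval x) G ≠ 0) ∧
      ∀ x y x' y', f.evalEval x y = 0 → b.eval x ≠ 0 → f.evalEval x' y' = 0 → b.eval x' ≠ 0 →
        (∀ j, (A j).evalEval x y / b.eval x = (A j).evalEval x' y' / b.eval x') →
        x = x' ∧ y = y' := by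
  obtain ⟨f, y₀, hf, hdvd, hfy, hfy', hz⟩ :=
    exists_integral_primitive_element_of_transcendental hx₀ (Fin t ⊕ Fin 3)
  obtain ⟨r₁, s₁, hs₁, hrs₁⟩ := hgen x₀
  obtain ⟨r₂, s₂, hs₂, hrs₂⟩ := hgen y₀
  set ρ := (algebraMap k L).comp ι with hρ
  obtain ⟨a, b, hb, hab⟩ := hz (Sum.elim p ![(MvPolynomial.eval₂ ρ p G)⁻¹,
    (MvPolynomial.eval₂ ρ p s₁)⁻¹, (MvPolynomial.eval₂ ρ p s₂)⁻¹])
  let T := τ.comp (algebraMap k L)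
  let φ : k₀ →+* AdjoinRoot f := ((AdjoinRoot.of f).comp C).comp ι
  let ψ : AdjoinRoot f →+* L := AdjoinRoot.lift (eval₂RingHom (algebraMap k L) x₀) y₀ hfy
  have hψ : Function.Injective ψ := by
    rw [injective_iff_map_eq_zero]
    intro u hu
    obtain ⟨u, rfl⟩ := AdjoinRoot.mk_surjective u
    rw [AdjoinRoot.mk_eq_zero]
    rw [AdjoinRoot.lift_mk] at hu
    exact hdvd u hu
  have hψφ : ψ.comp φ = ρ := by
    ext c
    simp [ψ, φ, hρ]
  have hψb : ψ (AdjoinRoot.of f b) ≠ 0 := by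
    simpa [ψ] using hb
  have hψp : (fun j => ψ (AdjoinRoot.mk f (a (Sum.inl j))) / ψ (AdjoinRoot.of f b)) = p := by
    funext j
    have h1 := hab (Sum.inl j)
    rw [div_eq_iff hψb]
    simp only [Sum.elim_inl] at h1
    simp only [ψ, AdjoinRoot.lift_mk, AdjoinRoot.lift_of, ← h1, coe_eval₂RingHom]
    ring
  have hinv : ∀ i (g : MvPolynomial (Fin t) k₀), MvPolynomial.eval₂ ρ p g ≠ 0 →
      (Sum.elim p ![(MvPolynomial.eval₂ ρ p G)⁻¹, (MvPolynomial.eval₂ ρ p s₁)⁻¹,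
        (MvPolynomial.eval₂ ρ p s₂)⁻¹]) (Sum.inr i) = (MvPolynomial.eval₂ ρ p g)⁻¹ →
      MvPolynomial.eval₂ (ψ.comp φ)
        (fun j => ψ (AdjoinRoot.mk f (a (Sum.inl j))) / ψ (AdjoinRoot.of f b)) g *
        ψ (AdjoinRoot.mk f (a (Sum.inr i))) = ψ (AdjoinRoot.of f b) := by
    intro i g hg hi
    have h1 := hab (Sum.inr i)
    rw [hi] at h1
    rw [hψφ, hψp]
    simp only [ψ, AdjoinRoot.lift_mk, AdjoinRoot.lift_of, ← h1, coe_eval₂RingHom]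
    field_simp
  have hev : ∀ (q : k[X][X]) x y, (q.map (mapRingHom T)).evalEval x y =
      eval₂ (eval₂RingHom T x) y q := fun q x y => (eval₂_eval₂RingHom_apply _ _ _ _).symm
  have hTmap : ∀ q : k[X][X], (q.map (mapRingHom T)).evalEval (τ x₀) (τ y₀) =
      τ (eval₂ (eval₂RingHom (algebraMap k L) x₀) y₀ q) := by
    intro q
    rw [hev, hom_eval₂]
    congr 1
    ext <;> simp [T]
  have hθ : ∀ x y, (f.map (mapRingHom T)).evalEval x y = 0 → (b.map T).eval x ≠ 0 →
      ∃ θ : AdjoinRoot f →+* K, θ.comp φ = τ.comp ρ ∧ θ (AdjoinRoot.of f b) ≠ 0 ∧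
        (fun j => θ (AdjoinRoot.mk f (a (Sum.inl j))) / θ (AdjoinRoot.of f b)) =
          (fun j => ((a (Sum.inl j)).map (mapRingHom T)).evalEval x y / (b.map T).eval x) ∧
        θ (AdjoinRoot.of f X) = x ∧ θ (AdjoinRoot.root f) = y := by
    intro x y hxy hbx
    rw [hev] at hxy
    rw [eval_map] at hbx
    refine ⟨AdjoinRoot.lift (eval₂RingHom T x) y hxy, ?_, ?_, ?_, ?_, ?_⟩
    · ext c; simp [φ, T, hρ]
    · simpa using hbx
    · funext j
      rw [AdjoinRoot.lift_mk, hev, eval_map, AdjoinRoot.lift_of, coe_eval₂RingHom]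
    · simp
    · simp
  refine ⟨f.map (mapRingHom T), fun j => (a (Sum.inl j)).map (mapRingHom T), b.map T,
    τ x₀, τ y₀, hf.map _, ?_, ?_, ?_, ?_, ?_⟩
  · rw [hTmap, hfy, map_zero]
  · rw [derivative_map, hTmap]
    exact (map_ne_zero τ).2 hfy'
  · rw [eval_map]
    change eval₂ (τ.comp (algebraMap k L)) (τ x₀) b ≠ 0
    rw [← hom_eval₂]
    exact (map_ne_zero τ).2 hb
  · intro x y hxy hbx
    obtain ⟨θ, hθφ, hθb, hθa, -, -⟩ := hθ x y hxy hbx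
    constructor
    · intro H hH
      have h1 := eval₂_eq_zero_of_specialization φ hψb hθb hψ (H := H)
        (a := fun j => AdjoinRoot.mk f (a (Sum.inl j))) (by rw [hψp, hψφ, hH])
      rwa [hθa, hθφ] at h1
    · have h1 := eval₂_ne_zero_of_specialization φ hψb hθb hψ (H := G)
        (a := fun j => AdjoinRoot.mk f (a (Sum.inl j))) (hinv 0 G hG rfl)
      rwa [hθa, hθφ] at h1
  · intro x y x' y' hxy hbx hxy' hbx' heq
    obtain ⟨θ, hθφ, hθb, hθa, hθx, hθy⟩ := hθ x y hxy hbx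
    obtain ⟨θ', hθφ', hθb', hθa', hθx', hθy'⟩ := hθ x' y' hxy' hbx'
    have key : ∀ i (r s : MvPolynomial (Fin t) k₀) (u : AdjoinRoot f),
        MvPolynomial.eval₂ ρ p s ≠ 0 → (Sum.elim p ![(MvPolynomial.eval₂ ρ p G)⁻¹,
          (MvPolynomial.eval₂ ρ p s₁)⁻¹, (MvPolynomial.eval₂ ρ p s₂)⁻¹]) (Sum.inr i) =
          (MvPolynomial.eval₂ ρ p s)⁻¹ →
        MvPolynomial.eval₂ ρ p s * ψ u = MvPolynomial.eval₂ ρ p r → θ u = θ' u := by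
      intro i r s u hs hi hu
      have h1 := eval₂_ne_zero_of_specialization φ hψb hθb hψ
        (a := fun j => AdjoinRoot.mk f (a (Sum.inl j))) (hinv i s hs hi)
      have h2 := eval₂_mul_eq_of_specialization φ hψb hθb hψ (H := s) (H' := r) (x := u)
        (a := fun j => AdjoinRoot.mk f (a (Sum.inl j))) (by rw [hψp, hψφ, hu])
      have h3 := eval₂_mul_eq_of_specialization φ hψb hθb' hψ (H := s) (H' := r) (x := u)
        (a := fun j => AdjoinRoot.mk f (a (Sum.inl j))) (by rw [hψp, hψφ, hu])
      rw [hθa, hθφ] at h1 h2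
      rw [hθa', hθφ', ← funext heq] at h3
      exact mul_left_cancel₀ h1 (h2.trans h3.symm)
    constructor
    · rw [← hθx, ← hθx']
      exact key 1 r₁ s₁ _ hs₁ rfl (by simpa [ψ] using hrs₁)
    · rw [← hθy, ← hθy']
      exact key 2 r₂ s₂ _ hs₂ rfl (by simpa [ψ] using hrs₂)

open IntermediateField in
/-- A point with a transcendental coordinate spreads out to a plane curve with a smooth rational
point, together with an injective rational map to affine space through which every polynomial
relation of the given point persists. -/
lemma exists_curve_model {k₀ K : Type*} [Field k₀] [PerfectField k₀] [Field K] [Algebra k₀ K]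
    {t : ℕ} (P : Fin t → K) (hP : ∃ j, Transcendental k₀ (P j)) {G : MvPolynomial (Fin t) k₀}
    (hG : MvPolynomial.aeval P G ≠ 0) :
    ∃ (f : K[X][X]) (A : Fin t → K[X][X]) (b : K[X]) (x y : K), f.Monic ∧
      f.evalEval x y = 0 ∧ (derivative f).evalEval x y ≠ 0 ∧ b.eval x ≠ 0 ∧
      (∀ x y, f.evalEval x y = 0 → b.eval x ≠ 0 →
        (∀ H : MvPolynomial (Fin t) k₀, MvPolynomial.aeval P H = 0 →
          MvPolynomial.aeval (fun j => (A j).evalEval x y / b.eval x) H = 0) ∧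
        MvPolynomial.aeval (fun j => (A j).evalEval x y / b.eval x) G ≠ 0) ∧
      ∀ x y x' y', f.evalEval x y = 0 → b.eval x ≠ 0 → f.evalEval x' y' = 0 → b.eval x' ≠ 0 →
        (∀ j, (A j).evalEval x y / b.eval x = (A j).evalEval x' y' / b.eval x') →
        x = x' ∧ y = y' := by
  set L := adjoin k₀ (Set.range P) with hLdef
  let p : Fin t → L := fun j => ⟨P j, subset_adjoin k₀ _ ⟨j, rfl⟩⟩
  have hp : ∀ H : MvPolynomial (Fin t) k₀, algebraMap L K (MvPolynomial.aeval p H) =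
      MvPolynomial.aeval P H := by
    intro H
    rw [← MvPolynomial.aeval_algebraMap_apply]
    rfl
  have : Algebra.EssFiniteType k₀ L := by
    rw [IntermediateField.essFiniteType_iff]
    exact fg_adjoin_of_finite (Set.finite_range P)
  have hL : ¬ Algebra.IsAlgebraic k₀ L := by
    rintro ⟨h⟩
    obtain ⟨j, hj⟩ := hP
    exact hj ((h (p j)).algebraMap (A := K))
  obtain ⟨k, x₀, hx₀, hfin, hsep⟩ := exists_separable_simple_transcendental hL
  have hρ : (algebraMap k L).comp (algebraMap k₀ k) = algebraMap k₀ L := rfl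
  have hτ : (algebraMap L K).comp (algebraMap k₀ L) = algebraMap k₀ K := rfl
  have hgen : ∀ z : L, ∃ r s : MvPolynomial (Fin t) k₀, MvPolynomial.aeval p s ≠ 0 ∧
      MvPolynomial.aeval p s * z = MvPolynomial.aeval p r := by
    intro z
    obtain ⟨r, s, h⟩ := (mem_adjoin_range_iff k₀ P (z : K)).1 z.2
    by_cases hs : MvPolynomial.aeval p s = 0
    · refine ⟨0, 1, by simp, ?_⟩
      rw [← hp s, hs, map_zero, div_zero] at h
      have hz : z = 0 := Subtype.ext h
      rw [map_zero, hz, mul_zero]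
    · refine ⟨r, s, hs, Subtype.ext ?_⟩
      have hs' : MvPolynomial.aeval P s ≠ 0 := by
        rw [← hp]
        exact (_root_.map_ne_zero _).2 hs
      change algebraMap L K (MvPolynomial.aeval p s) * (z : K) =
        algebraMap L K (MvPolynomial.aeval p r)
      rw [h, hp, hp]
      field_simp
  have hG' : MvPolynomial.aeval p G ≠ 0 := by
    intro h
    rw [← hp, h, map_zero] at hG
    exact hG rfl
  obtain ⟨f, A, b, x, y, h1, h2, h3, h4, h5, h6⟩ := exists_curve_model_of_transcendental hx₀
    (algebraMap k₀ k) (algebraMap L K) p hgen hG'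
  refine ⟨f, A, b, x, y, h1, h2, h3, h4, fun x y hx hy => ⟨fun H hH => ?_, (h5 x y hx hy).2⟩, h6⟩
  refine (h5 x y hx hy).1 H ?_
  change MvPolynomial.aeval p H = 0
  rw [← hp] at hH
  exact (map_eq_zero _).1 hH

end PlaneCurve

namespace PlaneCurve

open Filter

lemma exists_ultraproduct_field (φ : Ultrafilter ℕ) (F : ℕ → Type) [∀ n, Field (F n)] :
    ∃ (K : Type) (_ : Field K) (π : (∀ n, F n) →+* K), Function.Surjective π ∧
      ∀ a, π a = 0 ↔ ∀ᶠ n in φ, a n = 0 := by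
  let I : Ideal (∀ n, F n) :=
    { carrier := {a | ∀ᶠ n in φ, a n = 0}
      add_mem' := fun {a b} ha hb => by
        filter_upwards [ha, hb] with n h1 h2
        rw [Pi.add_apply, h1, h2, add_zero]
      zero_mem' := Eventually.of_forall fun _ => rfl
      smul_mem' := fun c a ha => by
        filter_upwards [ha] with n h1
        rw [smul_eq_mul, Pi.mul_apply, h1, mul_zero] }
  have hmem : ∀ a, a ∈ I ↔ ∀ᶠ n in φ, a n = 0 := fun _ => Iff.rfl
  have hI : I.IsMaximal := by
    classical
    rw [Ideal.isMaximal_iff]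
    refine ⟨fun h => ?_, fun J a hIJ ha haJ => ?_⟩
    · obtain ⟨n, hn⟩ := ((hmem _).1 h).exists
      exact one_ne_zero hn
    · have h1 : (1 - (fun n => (a n)⁻¹) * a) ∈ I := by
        rw [hmem] at ha ⊢
        filter_upwards [Ultrafilter.eventually_not.2 ha] with n hn
        simp [hn]
      have h2 := J.add_mem (hIJ h1) (J.mul_mem_left (fun n => (a n)⁻¹) haJ)
      rwa [sub_add_cancel] at h2
  exact ⟨_ ⧸ I, Ideal.Quotient.field I, Ideal.Quotient.mk I, Ideal.Quotient.mk_surjective,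
    fun a => Ideal.Quotient.eq_zero_iff_mem⟩

section Ultraproduct

variable {φ : Ultrafilter ℕ} {F : ℕ → Type} [∀ n, Field (F n)] {K : Type} [Field K]
  {π : (∀ n, F n) →+* K}

lemma perfectField_of_ultraproduct [∀ n, Finite (F n)] (hπ : Function.Surjective π)
    (hφ : ∀ a, π a = 0 ↔ ∀ᶠ n in φ, a n = 0) : PerfectField K := by
  obtain ⟨p, hp⟩ := ExpChar.exists K
  have : PerfectRing K p := by
    rcases hp with _ | hp
    · refine PerfectRing.ofSurjective K 1 fun x => ⟨x, by rw [frobenius_def, pow_one]⟩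
    · have : Fact p.Prime := ⟨hp⟩
      refine PerfectRing.ofSurjective K p fun x => ?_
      obtain ⟨a, rfl⟩ := hπ x
      have h1 : ∀ᶠ n in φ, ((p : ∀ n, F n)) n = 0 := by
        rw [← hφ, map_natCast, CharP.cast_eq_zero]
      have h2 : ∀ n, ∃ r : F n, (p : F n) = 0 → r ^ p = a n := by
        intro n
        by_cases hn : (p : F n) = 0
        · have : CharP (F n) p := (CharP.charP_iff_prime_eq_zero hp).2 hn
          obtain ⟨r, hr⟩ := (bijective_frobenius (F n) p).2 (a n)
          exact ⟨r, fun _ => hr⟩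
        · exact ⟨0, fun h => absurd h hn⟩
      choose r hr using h2
      refine ⟨π r, ?_⟩
      rw [frobenius_def, ← map_pow, ← sub_eq_zero, ← map_sub, hφ]
      filter_upwards [h1] with n hn
      rw [Pi.sub_apply, Pi.pow_apply, hr n (by simpa using hn), sub_self]
  exact PerfectRing.toPerfectField K p

lemma eventually_ne_of_map_ne (hφ : ∀ a, π a = 0 ↔ ∀ᶠ n in φ, a n = 0) {a : ∀ n, F n}
    (ha : π a ≠ 0) : ∀ᶠ n in φ, a n ≠ 0 :=
  Ultrafilter.eventually_not.2 fun h => ha ((hφ a).2 h)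

lemma map_ne_of_eventually_ne (hφ : ∀ a, π a = 0 ↔ ∀ᶠ n in φ, a n = 0) {a : ∀ n, F n}
    (ha : ∀ᶠ n in φ, a n ≠ 0) : π a ≠ 0 :=
  fun h => Ultrafilter.eventually_not.1 ha ((hφ a).1 h)

lemma map_eq_map_of_eventually_eq (hφ : ∀ a, π a = 0 ↔ ∀ᶠ n in φ, a n = 0) {a b : ∀ n, F n}
    (hab : ∀ᶠ n in φ, a n = b n) : π a = π b := by
  rw [← sub_eq_zero, ← map_sub, hφ]
  filter_upwards [hab] with n hn
  rw [Pi.sub_apply, hn, sub_self]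

lemma eventually_eq_of_map_eq_map (hφ : ∀ a, π a = 0 ↔ ∀ᶠ n in φ, a n = 0) {a b : ∀ n, F n}
    (hab : π a = π b) : ∀ᶠ n in φ, a n = b n := by
  rw [← sub_eq_zero, ← map_sub, hφ] at hab
  filter_upwards [hab] with n hn
  exact sub_eq_zero.1 hn

/-- Polynomials of bounded degree over the fields `F n` come from one polynomial over the
product. -/
lemma exists_mvPolynomial_pi {t M : ℕ} (p : ∀ n, MvPolynomial (Fin t) (F n))
    (hp : ∀ n, (p n).totalDegree ≤ M) :
    ∃ P : MvPolynomial (Fin t) (∀ n, F n), ∀ n,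
      MvPolynomial.map (Pi.evalRingHom F n) P = p n := by
  classical
  refine ⟨∑ m ∈ Finset.Iic (Finsupp.equivFunOnFinite.symm fun _ => M),
    MvPolynomial.monomial m fun n => (p n).coeff m, fun n => ?_⟩
  simp only [map_sum, MvPolynomial.map_monomial, Pi.evalRingHom_apply]
  conv_rhs => rw [(p n).as_sum]
  symm
  refine Finset.sum_subset (fun m hm => ?_) (fun m _ hm => ?_)
  · rw [Finset.mem_Iic]
    intro i
    exact (MvPolynomial.monomial_le_degreeOf i hm).trans
      ((MvPolynomial.degreeOf_le_totalDegree _ _).trans (hp n))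
  · rw [MvPolynomial.notMem_support_iff.1 hm, map_zero]

lemma eval_map_ultraproduct {t : ℕ} (P : MvPolynomial (Fin t) (∀ n, F n))
    (a : Fin t → ∀ n, F n) :
    MvPolynomial.eval (fun j => π (a j)) (MvPolynomial.map π P) =
      π fun n => MvPolynomial.eval (fun j => a j n) (MvPolynomial.map (Pi.evalRingHom F n) P) := by
  change MvPolynomial.eval (π ∘ a) _ = _
  rw [← MvPolynomial.map_eval]
  congr 1
  funext n
  exact MvPolynomial.map_eval (Pi.evalRingHom F n) a P

/-- An ultraproduct of sets of unbounded cardinality, as a set of points over the ultraproduct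
field, is uncountable. -/
lemma not_countable_ultraproduct (hle : (φ : Filter ℕ) ≤ atTop)
    (hφ : ∀ a, π a = 0 ↔ ∀ᶠ n in φ, a n = 0) {t : ℕ} (S : ∀ n, Set (Fin t → F n))
    (hS : ∀ n, 2 ^ n ≤ Nat.card (S n)) :
    ¬ {P : Fin t → K | ∃ a : Fin t → ∀ n, F n, (∀ n, (fun j => a j n) ∈ S n) ∧
      P = fun j => π (a j)}.Countable := by
  intro hc
  have h1 : ∀ n, ∃ e : (Fin n → Bool) → S n, Function.Injective e := by
    intro n
    have hfin : Finite (S n) := Nat.finite_of_card_ne_zero ((Nat.two_pow_pos n).trans_le (hS n)).ne'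
    have := Fintype.ofFinite (S n)
    have h2 : Fintype.card (Fin n → Bool) ≤ Fintype.card (S n) := by
      rw [← Nat.card_eq_fintype_card (α := S n)]
      simpa using hS n
    obtain ⟨e⟩ := Function.Embedding.nonempty_of_card_le h2
    exact ⟨e, e.injective⟩
  choose e he using h1
  let Φ : (ℕ → Bool) → {P : Fin t → K | ∃ a : Fin t → ∀ n, F n, (∀ n, (fun j => a j n) ∈ S n) ∧
      P = fun j => π (a j)} := fun σ =>
    ⟨fun j => π fun n => (e n fun i => σ i).1 j, fun j n => (e n fun i => σ i).1 j,
      fun n => (e n fun i => σ i).2, rfl⟩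
  have hΦ : Function.Injective Φ := by
    intro σ σ' h
    by_contra hne
    obtain ⟨m, hm⟩ := Function.ne_iff.1 hne
    have h2 : ∀ j, ∀ᶠ n in φ, (e n fun i => σ i).1 j = (e n fun i => σ' i).1 j := fun j =>
      eventually_eq_of_map_eq_map hφ (congrFun (congrArg Subtype.val h) j)
    obtain ⟨n, hn, hmn⟩ := ((eventually_all.2 h2).and (hle (eventually_gt_atTop m))).exists
    have h3 := he n (Subtype.ext (funext hn))
    exact hm (congrFun h3 ⟨m, hmn⟩)
  have : Countable {P : Fin t → K | ∃ a : Fin t → ∀ n, F n, (∀ n, (fun j => a j n) ∈ S n) ∧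
      P = fun j => π (a j)} := hc
  have h4 : Countable (ℕ → Bool) := hΦ.countable
  have h5 := Cardinal.mk_le_aleph0_iff.2 h4
  rw [Cardinal.mk_pi] at h5
  simp at h5
  exact absurd h5 (not_le.2 (Cardinal.cantor _))

end Ultraproduct

/-- Countably many elements of a perfect field lie in a countable perfect subfield. -/
lemma exists_countable_perfect_subfield {K : Type} [Field K] [PerfectField K] {s : Set K}
    (hs : s.Countable) : ∃ k : Subfield K, PerfectField k ∧ Countable k ∧ s ⊆ k := by
  let k₁ := Subfield.closure s
  have h1 : Countable k₁ := by
    rw [← Cardinal.mk_le_aleph0_iff]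
    refine (Subfield.cardinalMk_closure_le_max s).trans (max_le ?_ le_rfl)
    exact Cardinal.mk_le_aleph0_iff.2 hs
  have h2 : Countable (perfectClosure k₁ K) := by
    rw [← Cardinal.mk_le_aleph0_iff]
    exact (Algebra.IsAlgebraic.cardinalMk_le_max k₁ _).trans
      (max_le (Cardinal.mk_le_aleph0_iff.2 h1) le_rfl)
  refine ⟨(perfectClosure k₁ K).toSubfield, perfectClosure.perfectField k₁ K, h2, fun x hx => ?_⟩
  exact (perfectClosure k₁ K).algebraMap_mem ⟨x, Subfield.subset_closure hx⟩

end PlaneCurve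

namespace PlaneCurve

open Filter hiding map

open Classical in
lemma card_filter_evalEval_le {F : Type} [Field F] [Fintype F] {d e t : ℕ} {f : F[X][X]}
    (hf : f.Monic) (hd : f.natDegree ≤ d) {b : F[X]} (hb : b ≠ 0) (he : b.natDegree ≤ e)
    {S : Set (Fin t → F)} {A : F → F → Fin t → F}
    (hA : ∀ x y, f.evalEval x y = 0 → b.eval x ≠ 0 → A x y ∈ S)
    (hinj : ∀ x y x' y', f.evalEval x y = 0 → b.eval x ≠ 0 → f.evalEval x' y' = 0 →
      b.eval x' ≠ 0 → A x y = A x' y' → x = x' ∧ y = y') :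
    (Finset.univ.filter fun p : F × F => f.evalEval p.1 p.2 = 0).card ≤ Nat.card S + d * e := by
  rw [← Finset.card_filter_add_card_filter_not (fun p : F × F => b.eval p.1 ≠ 0)]
  refine Nat.add_le_add ?_ ?_
  · rw [Nat.card_eq_fintype_card, ← Set.toFinset_card]
    refine Finset.card_le_card_of_injOn (fun p => A p.1 p.2) (fun p hp => ?_) ?_
    · simp only [Finset.coe_filter, Finset.mem_filter, Finset.mem_univ, true_and,
        Set.mem_ofPred_eq] at hp
      simpa using hA _ _ hp.1 hp.2
    · intro p hp p' hp' h
      simp only [Finset.coe_filter, Finset.mem_filter, Finset.mem_univ, true_and,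
        Set.mem_ofPred_eq] at hp hp'
      obtain ⟨h1, h2⟩ := hinj _ _ _ _ hp.1 hp.2 hp'.1 hp'.2 h
      exact Prod.ext h1 h2
  · refine (Finset.card_le_mul_card_image (f := Prod.fst) _ d fun x _ => ?_).trans
      (Nat.mul_le_mul_left _ ?_)
    · refine le_trans ?_ ((card_le_of_evalEval_eq_zero hf x
        (Finset.univ.filter fun y => f.evalEval x y = 0) (by simp)).trans hd)
      refine Finset.card_le_card_of_injOn Prod.snd (fun p hp => ?_) ?_
      · simp only [Finset.coe_filter, Finset.mem_filter, Finset.mem_univ, true_and,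
          Set.mem_ofPred_eq] at hp ⊢
        rw [← hp.2]
        exact hp.1.1
      · intro p hp p' hp' h
        simp only [Finset.coe_filter, Finset.mem_filter, Finset.mem_univ, true_and,
          Set.mem_ofPred_eq] at hp hp'
        exact Prod.ext (hp.2.trans hp'.2.symm) h
    · refine le_trans (Finset.card_le_card (t := b.roots.toFinset) fun x hx => ?_)
        ((Multiset.toFinset_card_le _).trans ((card_roots' b).trans he))
      obtain ⟨p, hp, rfl⟩ := Finset.mem_image.1 hx
      simp only [Finset.mem_filter, Finset.mem_univ, true_and, not_not] at hp
      rw [Multiset.mem_toFinset, mem_roots hb]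
      exact hp.2

lemma exists_xDegLE {R : Type*} [CommRing R] (f : R[X][X]) :
    ∃ D, ∀ i, (f.coeff i).natDegree ≤ D := by
  refine ⟨f.support.sup fun i => (f.coeff i).natDegree, fun i => ?_⟩
  by_cases hi : i ∈ f.support
  · exact Finset.le_sup (f := fun i => (f.coeff i).natDegree) hi
  · rw [notMem_support_iff.1 hi, natDegree_zero]
    exact Nat.zero_le _

lemma exists_eventually_not {φ : Ultrafilter ℕ} {α : ℕ → Type*} [∀ n, Nonempty (α n)]
    {p : ∀ n, α n → Prop} (h : ¬ ∀ᶠ n in φ, ∀ x, p n x) :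
    ∃ x : ∀ n, α n, ∀ᶠ n in φ, ¬ p n (x n) := by
  classical
  have h1 : ∀ n, ∃ x, p n x → ∀ x, p n x := fun n => by
    by_cases hn : ∀ x, p n x
    · exact ⟨Classical.arbitrary _, fun _ => hn⟩
    · obtain ⟨x, hx⟩ := not_forall.1 hn
      exact ⟨x, fun h => absurd h hx⟩
  choose x hx using h1
  exact ⟨x, (Ultrafilter.eventually_not.2 h).mono fun n hn h => hn (hx n h)⟩

section Ultraproduct

variable {φ : Ultrafilter ℕ} {F : ℕ → Type} [∀ n, Field (F n)] {K : Type} [Field K]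
  {π : (∀ n, F n) →+* K}

lemma map_div_of_ultraproduct (hφ : ∀ a, π a = 0 ↔ ∀ᶠ n in φ, a n = 0) (a : ∀ n, F n)
    {c : ∀ n, F n} (hc : π c ≠ 0) : π (fun n => a n / c n) = π a / π c := by
  rw [eq_div_iff hc, ← map_mul]
  refine map_eq_map_of_eventually_eq hφ ?_
  filter_upwards [eventually_ne_of_map_ne hφ hc] with n hn
  exact div_mul_cancel₀ _ hn

/-- A curve with a smooth rational point over an ultraproduct field, mapping injectively to the
ultraproduct of the sets `S n`, forces the lower bound of Hasse-Weil type on the `S n`. -/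
lemma exists_eventually_card_le [∀ n, Fintype (F n)] (hπ : Function.Surjective π)
    (hφ : ∀ a, π a = 0 ↔ ∀ᶠ n in φ, a n = 0) {t : ℕ} (S : ∀ n, Set (Fin t → F n))
    {f : K[X][X]} {A : Fin t → K[X][X]} {b : K[X]} {x₀ y₀ : K} (hf : f.Monic)
    (h0 : f.evalEval x₀ y₀ = 0) (h1 : (derivative f).evalEval x₀ y₀ ≠ 0) (hb : b.eval x₀ ≠ 0)
    (hA : ∀ x y, f.evalEval x y = 0 → b.eval x ≠ 0 → ∀ a : Fin t → ∀ n, F n,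
      (∀ j, (A j).evalEval x y / b.eval x = π (a j)) → ∀ᶠ n in φ, (fun j => a j n) ∈ S n)
    (hinj : ∀ x y x' y', f.evalEval x y = 0 → b.eval x ≠ 0 → f.evalEval x' y' = 0 →
      b.eval x' ≠ 0 → (∀ j, (A j).evalEval x y / b.eval x = (A j).evalEval x' y' / b.eval x') →
        x = x' ∧ y = y') :
    ∃ C : ℕ, ∀ᶠ n in φ,
      Fintype.card (F n) ≤ Nat.card (S n) + C * Nat.sqrt (Fintype.card (F n)) := by
  classical
  have hsurj2 : Function.Surjective (map (mapRingHom π)) :=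
    map_surjective (mapRingHom π) (map_surjective π hπ)
  obtain ⟨f, rfl, -, hf⟩ := lifts_and_natDegree_eq_and_monic
    (f := mapRingHom π) (p := f) ((mem_lifts _).2 (hsurj2 f)) hf
  obtain ⟨b, rfl⟩ := map_surjective _ hπ b
  choose A' hA' using fun j => hsurj2 (A j)
  obtain rfl : (fun j => map (mapRingHom π) (A' j)) = A := funext hA'
  obtain ⟨x₀, rfl⟩ := hπ x₀
  obtain ⟨y₀, rfl⟩ := hπ y₀
  simp only [derivative_map, map_mapRingHom_evalEval, eval_map_apply] at h0 h1 hb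
  obtain ⟨D, hD⟩ := exists_xDegLE f
  obtain ⟨C, hC⟩ := exists_card_le_of_smooth f.natDegree D
  let ε := fun n => Pi.evalRingHom F n
  have hev : ∀ (p : (∀ n, F n)[X][X]) (x y : ∀ n, F n) n,
      (p.map (mapRingHom (ε n))).evalEval (x n) (y n) = p.evalEval x y n := fun p x y n =>
    map_mapRingHom_evalEval (ε n) p x y
  have hev' : ∀ (p : (∀ n, F n)[X]) (x : ∀ n, F n) n, (p.map (ε n)).eval (x n) = p.eval x n :=
    fun p x n => eval_map_apply (ε n) x
  have hmaps : ∀ᶠ n in φ, ∀ p : F n × F n, (f.map (mapRingHom (ε n))).evalEval p.1 p.2 = 0 →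
      (b.map (ε n)).eval p.1 ≠ 0 → (fun j => ((A' j).map (mapRingHom (ε n))).evalEval p.1 p.2 /
        (b.map (ε n)).eval p.1) ∈ S n := by
    by_contra hcon
    obtain ⟨p, hp⟩ := exists_eventually_not hcon
    let x := fun n => (p n).1
    let y := fun n => (p n).2
    have hp' : ∀ᶠ n in φ, f.evalEval x y n = 0 ∧ b.eval x n ≠ 0 ∧
        (fun j => (A' j).evalEval x y n / b.eval x n) ∉ S n := by
      filter_upwards [hp] with n hn
      simp only [Classical.not_imp] at hn
      simpa only [← hev, ← hev'] using hn
    have h2 : (f.map (mapRingHom π)).evalEval (π x) (π y) = 0 := by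
      rw [map_mapRingHom_evalEval, hφ]
      exact hp'.mono fun n hn => hn.1
    have h3 : π (b.eval x) ≠ 0 := map_ne_of_eventually_ne hφ (hp'.mono fun n hn => hn.2.1)
    have h4 := hA (π x) (π y) h2 (by rwa [eval_map_apply])
      (fun j n => (A' j).evalEval x y n / b.eval x n) fun j => by
        rw [map_div_of_ultraproduct hφ _ h3, map_mapRingHom_evalEval, eval_map_apply]
    obtain ⟨n, hn, hn'⟩ := (h4.and hp').exists
    exact hn'.2.2 hn
  have hinjs : ∀ᶠ n in φ, ∀ p : (F n × F n) × (F n × F n),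
      (f.map (mapRingHom (ε n))).evalEval p.1.1 p.1.2 = 0 → (b.map (ε n)).eval p.1.1 ≠ 0 →
      (f.map (mapRingHom (ε n))).evalEval p.2.1 p.2.2 = 0 → (b.map (ε n)).eval p.2.1 ≠ 0 →
      (fun j => ((A' j).map (mapRingHom (ε n))).evalEval p.1.1 p.1.2 /
        (b.map (ε n)).eval p.1.1) = (fun j => ((A' j).map (mapRingHom (ε n))).evalEval p.2.1 p.2.2 /
        (b.map (ε n)).eval p.2.1) → p.1.1 = p.2.1 ∧ p.1.2 = p.2.2 := by
    by_contra hcon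
    obtain ⟨p, hp⟩ := exists_eventually_not hcon
    let x := fun n => (p n).1.1
    let y := fun n => (p n).1.2
    let x' := fun n => (p n).2.1
    let y' := fun n => (p n).2.2
    have hp' : ∀ᶠ n in φ, f.evalEval x y n = 0 ∧ b.eval x n ≠ 0 ∧ f.evalEval x' y' n = 0 ∧
        b.eval x' n ≠ 0 ∧ (fun j => (A' j).evalEval x y n / b.eval x n) =
          (fun j => (A' j).evalEval x' y' n / b.eval x' n) ∧ ¬ (x n = x' n ∧ y n = y' n) := by
      filter_upwards [hp] with n hn
      simp only [Classical.not_imp] at hn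
      simpa only [← hev, ← hev'] using hn
    have h2 : (f.map (mapRingHom π)).evalEval (π x) (π y) = 0 := by
      rw [map_mapRingHom_evalEval, hφ]
      exact hp'.mono fun n hn => hn.1
    have h3 : π (b.eval x) ≠ 0 := map_ne_of_eventually_ne hφ (hp'.mono fun n hn => hn.2.1)
    have h2' : (f.map (mapRingHom π)).evalEval (π x') (π y') = 0 := by
      rw [map_mapRingHom_evalEval, hφ]
      exact hp'.mono fun n hn => hn.2.2.1
    have h3' : π (b.eval x') ≠ 0 :=
      map_ne_of_eventually_ne hφ (hp'.mono fun n hn => hn.2.2.2.1)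
    obtain ⟨h4, h5⟩ := hinj (π x) (π y) (π x') (π y') h2 (by rwa [eval_map_apply]) h2'
      (by rwa [eval_map_apply]) fun j => by
        simp only [map_mapRingHom_evalEval, eval_map_apply]
        rw [← map_div_of_ultraproduct hφ _ h3, ← map_div_of_ultraproduct hφ _ h3']
        exact map_eq_map_of_eventually_eq hφ (hp'.mono fun n hn => congrFun hn.2.2.2.2.1 j)
    obtain ⟨n, ⟨hn, hn'⟩, hn''⟩ := (((eventually_eq_of_map_eq_map hφ h4).and
      (eventually_eq_of_map_eq_map hφ h5)).and hp').exists
    exact hn''.2.2.2.2.2 ⟨hn, hn'⟩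
  refine ⟨C + f.natDegree * b.natDegree, ?_⟩
  filter_upwards [(hφ _).1 h0, eventually_ne_of_map_ne hφ h1, eventually_ne_of_map_ne hφ hb,
    hmaps, hinjs] with n g0 g1 g2 g3 g4
  have hmonic := hf.map (mapRingHom (ε n))
  have hdeg : (f.map (mapRingHom (ε n))).natDegree ≤ f.natDegree := natDegree_map_le
  have h5 := hC (F n) (f.map (mapRingHom (ε n))) hmonic hdeg (fun i => by
    rw [coeff_map]
    exact natDegree_map_le.trans (hD i)) (x₀ n) (y₀ n) (by rw [hev, g0])
    (by rw [derivative_map, hev]; exact g1)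
  have h6 := card_filter_evalEval_le hmonic hdeg (b := b.map (ε n))
    (fun h => g2 (by rw [← hev', h, eval_zero])) natDegree_map_le
    (fun x y => g3 (x, y)) (fun x y x' y' => g4 ((x, y), (x', y')))
  have h7 : 1 ≤ Nat.sqrt (Fintype.card (F n)) := Nat.sqrt_pos.2 Fintype.card_pos
  calc Fintype.card (F n) ≤ _ := h5
    _ ≤ Nat.card (S n) + f.natDegree * b.natDegree +
        C * Nat.sqrt (Fintype.card (F n)) := Nat.add_le_add_right h6 _
    _ ≤ _ := by
      have := Nat.le_mul_of_pos_right (f.natDegree * b.natDegree) h7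
      rw [add_mul]
      omega

end Ultraproduct

end PlaneCurve

namespace PlaneCurve

open Filter

lemma exists_card_le_or_card_le (t s s' M : ℕ) : ∃ N : ℕ, ∀ (F : Type) [Field F] [Fintype F]
    (f : Fin s → MvPolynomial (Fin t) F) (g : Fin s' → MvPolynomial (Fin t) F),
    (∀ i, (f i).totalDegree ≤ M) → (∀ j, (g j).totalDegree ≤ M) →
    Nat.card {x : Fin t → F | (∀ i, MvPolynomial.eval x (f i) = 0) ∧
      ¬ ∀ j, MvPolynomial.eval x (g j) = 0} ≤ 2 ^ N ∨
    Fintype.card F ≤ Nat.card {x : Fin t → F | (∀ i, MvPolynomial.eval x (f i) = 0) ∧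
      ¬ ∀ j, MvPolynomial.eval x (g j) = 0} + N * Nat.sqrt (Fintype.card F) := by
  by_contra! hcon
  choose F hF hF' f g hf hg hbig hsmall using hcon
  let S : ∀ n, Set (Fin t → F n) := fun n => {x : Fin t → F n |
    (∀ i, MvPolynomial.eval x (f n i) = 0) ∧ ∃ j, MvPolynomial.eval x (g n j) ≠ 0}
  let φ := hyperfilter ℕ
  have hφ_le : (φ : Filter ℕ) ≤ atTop := Nat.hyperfilter_le_atTop
  obtain ⟨K, _, π, hπ, hφ⟩ := exists_ultraproduct_field φ F
  have := perfectField_of_ultraproduct hπ hφ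
  choose fR hfR using fun i => exists_mvPolynomial_pi (fun n => f n i) fun n => hf n i
  choose gR hgR using fun j => exists_mvPolynomial_pi (fun n => g n j) fun n => hg n j
  obtain ⟨k, hk, hkc, hks⟩ := exists_countable_perfect_subfield (K := K)
    ((Set.countable_range fun p : Fin s × (Fin t →₀ ℕ) => π ((fR p.1).coeff p.2)).union
      (Set.countable_range fun p : Fin s' × (Fin t →₀ ℕ) => π ((gR p.1).coeff p.2)))
  have hlift : ∀ p : MvPolynomial (Fin t) (∀ n, F n), (∀ m, π (p.coeff m) ∈ k) →
      ∃ q : MvPolynomial (Fin t) k,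
        MvPolynomial.map (algebraMap k K) q = MvPolynomial.map π p := by
    intro p hp
    refine MvPolynomial.mem_range_map_iff_coeffs_subset.2 ?_
    intro c hc
    obtain ⟨m, -, rfl⟩ := MvPolynomial.mem_coeffs_iff.1 hc
    rw [MvPolynomial.coeff_map]
    exact ⟨⟨_, hp m⟩, rfl⟩
  choose fk hfk using fun i => hlift (fR i) fun m => hks (Or.inl ⟨(i, m), rfl⟩)
  choose gk hgk using fun j => hlift (gR j) fun m => hks (Or.inr ⟨(j, m), rfl⟩)
  have haeval : ∀ (a : Fin t → ∀ n, F n) (p : ∀ n, MvPolynomial (Fin t) (F n))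
      (pR : MvPolynomial (Fin t) (∀ n, F n)) (pk : MvPolynomial (Fin t) k),
      (∀ n, MvPolynomial.map (Pi.evalRingHom F n) pR = p n) →
      MvPolynomial.map (algebraMap k K) pk = MvPolynomial.map π pR →
      MvPolynomial.aeval (fun j => π (a j)) pk =
        π fun n => MvPolynomial.eval (fun j => a j n) (p n) := by
    intro a p pR pk h1 h2
    rw [MvPolynomial.aeval_def, ← MvPolynomial.eval_map, h2, eval_map_ultraproduct]
    simp only [h1]
  obtain ⟨P, ⟨a, haS, rfl⟩, hP⟩ := Set.not_subset.1 fun h => not_countable_ultraproduct hφ_le hφ S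
    (fun n => (hbig n).le) ((Set.countable_univ_pi fun _ : Fin t =>
      Algebraic.countable k K).mono h)
  have hP' : ∃ j, Transcendental k (π (a j)) := by
    by_contra! h
    exact hP fun j _ => not_not.1 (h j)
  obtain ⟨j₀, hj₀⟩ : ∃ j, MvPolynomial.aeval (fun i => π (a i)) (gk j) ≠ 0 := by
    by_contra! h
    have h1 : ∀ᶠ n in φ, ∀ j, MvPolynomial.eval (fun i => a i n) (g n j) = 0 := by
      refine eventually_all.2 fun j => ?_
      have := h j
      rwa [haeval a _ _ _ (hgR j) (hgk j), hφ] at this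
    obtain ⟨n, hn⟩ := h1.exists
    obtain ⟨j, hj⟩ := (haS n).2
    exact hj (hn j)
  obtain ⟨q, A, b, x₀, y₀, hq, h0, h1, hb, hA, hinj⟩ := exists_curve_model _ hP' hj₀
  obtain ⟨C, hC⟩ := exists_eventually_card_le hπ hφ S hq h0 h1 hb (fun x y hx hy a' ha' => by
    obtain ⟨h2, h3⟩ := hA x y hx hy
    rw [funext ha'] at h2 h3
    rw [haeval a' _ _ _ (hgR j₀) (hgk j₀)] at h3
    have h4 : ∀ᶠ n in φ, ∀ i, MvPolynomial.eval (fun j => a' j n) (f n i) = 0 := by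
      refine eventually_all.2 fun i => (hφ _).1 ?_
      rw [← haeval a' _ _ _ (hfR i) (hfk i)]
      refine h2 _ ?_
      rw [haeval a _ _ _ (hfR i) (hfk i), hφ]
      exact Eventually.of_forall fun n => (haS n).1 i
    filter_upwards [h4, eventually_ne_of_map_ne hφ h3] with n h5 h6
    exact ⟨h5, j₀, h6⟩) hinj
  obtain ⟨n, hn, hCn⟩ := (hC.and (hφ_le (eventually_ge_atTop C))).exists
  have h2 := hsmall n
  have h3 := Nat.mul_le_mul_right (Nat.sqrt (Fintype.card (F n))) hCn
  change Nat.card (S n) + _ < _ at h2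
  omega

end PlaneCurve

/-- Lang–Weil-type dichotomy (Lemma 2.7 in Bukh–Conlon): for every `M ≥ 1` there are
constants `c_M` and `C_M` such that for every finite field `F` with `|F| = q` (so `q`
is a prime power), and all varieties `W`, `D` in at most `M` variables cut out by at
most `M` polynomials of degree at most `M` with coefficients in `F`, the set of
`F`-rational points of `W` not lying in `D` either has size at most `c_M`, or has
size at least `q(1 - C_M·q^{-1/2})`. -/
theorem variety_points_dichotomy (M : ℕ) (hM : 1 ≤ M) :
    ∃ c C : ℝ, ∀ (F : Type) [Field F] [Fintype F] (q t s s' : ℕ),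
      Fintype.card F = q → t ≤ M → s ≤ M → s' ≤ M →
      ∀ (f : Fin s → MvPolynomial (Fin t) F) (g : Fin s' → MvPolynomial (Fin t) F),
        (∀ i, (f i).totalDegree ≤ M) → (∀ j, (g j).totalDegree ≤ M) →
        (Nat.card {x : Fin t → F //
            (∀ i, MvPolynomial.eval x (f i) = 0) ∧
            ¬ (∀ j, MvPolynomial.eval x (g j) = 0)} : ℝ) ≤ c ∨
        (q : ℝ) * (1 - C * (q : ℝ) ^ (-(1 / 2) : ℝ)) ≤
          (Nat.card {x : Fin t → F //
            (∀ i, MvPolynomial.eval x (f i) = 0) ∧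
            ¬ (∀ j, MvPolynomial.eval x (g j) = 0)} : ℝ) := by
  choose N hN using PlaneCurve.exists_card_le_or_card_le
  let B := ∑ t ∈ Finset.range (M + 1), ∑ s ∈ Finset.range (M + 1), ∑ s' ∈ Finset.range (M + 1),
    N t s s' M
  have hB : ∀ t s s', t ≤ M → s ≤ M → s' ≤ M → N t s s' M ≤ B := by
    intro t s s' ht hs hs'
    refine le_trans ?_ (Finset.single_le_sum (fun _ _ => Nat.zero_le _)
      (Finset.mem_range.2 (Nat.lt_succ_of_le ht)))
    refine le_trans ?_ (Finset.single_le_sum (fun _ _ => Nat.zero_le _)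
      (Finset.mem_range.2 (Nat.lt_succ_of_le hs)))
    exact Finset.single_le_sum (f := fun s' => N t s s' M) (fun _ _ => Nat.zero_le _)
      (Finset.mem_range.2 (Nat.lt_succ_of_le hs'))
  refine ⟨2 ^ B, B, fun F _ _ q t s s' hq ht hs hs' f g hf hg => ?_⟩
  subst hq
  refine (hN t s s' M F f g hf hg).imp (fun h => ?_) fun h => ?_
  · exact_mod_cast h.trans (Nat.pow_le_pow_right two_pos (hB t s s' ht hs hs'))
  · have h1 := h.trans (Nat.add_le_add_left
      (Nat.mul_le_mul_right (Nat.sqrt (Fintype.card F)) (hB t s s' ht hs hs')) _)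
    have hq : (0 : ℝ) < Fintype.card F := by exact_mod_cast Fintype.card_pos
    have h2 : (Fintype.card F : ℝ) * (Fintype.card F : ℝ) ^ (-(1 / 2) : ℝ) =
        √(Fintype.card F : ℝ) := by
      rw [Real.sqrt_eq_rpow, ← Real.rpow_one_add' hq.le (by norm_num)]
      norm_num
    have h3 : (B : ℝ) * (Nat.sqrt (Fintype.card F) : ℝ) ≤ B * √(Fintype.card F : ℝ) :=
      mul_le_mul_of_nonneg_left Real.nat_sqrt_le_real_sqrt (Nat.cast_nonneg _)
    have h4 : (Fintype.card F : ℝ) ≤ Nat.card {x : Fin t → F //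
        (∀ i, MvPolynomial.eval x (f i) = 0) ∧ ¬ (∀ j, MvPolynomial.eval x (g j) = 0)} +
        B * (Nat.sqrt (Fintype.card F) : ℝ) := by exact_mod_cast h1
    rw [mul_sub, mul_one, mul_left_comm, h2]
    linarith
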